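/- arXiv:1711.09178 — 4 statements merged into one kernel-verified Lean document; each statement's English description precedes it below -/
import Mathlib

section
/- Let H = (V, E) be a balanced hypergraph on V = {1,...,n}, α ∈ ℕ^n, and s ≥ 1. Then the degree complex Δ_α(J(H)^s) is the simplicial complex generated by the sets V \ E for those edges E ∈ E with ∑_{i∈E} α_i ≤ s − 1. -/
open MvPolynomial

/-- A hypergraph (given by its edge set `E`) is balanced if every odd cycle
`(v₀,e₀,v₁,e₁,…,v_{k-1},e_{k-1},v₀)` (with `k ≥ 3` odd, written `k = 2m+3`) has an edge
containing at least three vertices of the cycle. -/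
def IsBalanced {V : Type*} [DecidableEq V] (E : Finset (Finset V)) : Prop :=
  ∀ (m : ℕ) (v : Fin (2 * m + 3) → V) (e : Fin (2 * m + 3) → Finset V),
    Function.Injective v → Function.Injective e → (∀ i, e i ∈ E) →
    (∀ i, v i ∈ e i ∧ v (i + 1) ∈ e i) →
    ∃ t, 3 ≤ (Finset.univ.filter fun j => v j ∈ e t).card

def IsVertexCover {n : ℕ} (E : Finset (Finset (Fin n))) (τ : Finset (Fin n)) : Prop :=
  ∀ e ∈ E, ∃ i ∈ e, i ∈ τ

def IsMinVertexCover {n : ℕ} (E : Finset (Finset (Fin n))) (τ : Finset (Fin n)) : Prop :=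
  IsVertexCover E τ ∧ ∀ τ' ⊂ τ, ¬ IsVertexCover E τ'

/-- The cover ideal of the hypergraph with edge set `E`. -/
noncomputable def coverIdeal {n : ℕ} (K : Type*) [Field K] (E : Finset (Finset (Fin n))) :
    Ideal (MvPolynomial (Fin n) K) :=
  Ideal.span {p | ∃ τ : Finset (Fin n), IsMinVertexCover E τ ∧ p = ∏ i ∈ τ, X i}

/-- `x^α ∈ I·R_F` for the localization `R_F` inverting the variables `x_i, i ∈ F`. -/
def memLocalized {n : ℕ} {K : Type*} [Field K] (I : Ideal (MvPolynomial (Fin n) K))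
    (F : Finset (Fin n)) (p : MvPolynomial (Fin n) K) : Prop :=
  ∃ k : ℕ, p * (∏ i ∈ F, X i) ^ k ∈ I

/-- The degree complex `Δ_α(I)` at `α ∈ ℕⁿ` (so `G_α = ∅`). -/
noncomputable def degreeComplex {n : ℕ} {K : Type*} [Field K]
    (I : Ideal (MvPolynomial (Fin n) K)) (α : Fin n → ℕ) : Set (Finset (Fin n)) :=
  {F : Finset (Fin n) | ¬ memLocalized I F (∏ i, X i ^ α i)}

/-- The graph of edges of `E` whose trace on `W` has two elements. -/
def traceGraph {V : Type*} [DecidableEq V] (E : Finset (Finset V)) (W : Finset V) :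
    SimpleGraph V where
  Adj a b := a ≠ b ∧ ∃ e ∈ E, e ∩ W = {a, b}
  symm := ⟨fun a b h => ⟨h.1.symm, by
    obtain ⟨e, he, h2⟩ := h.2
    exact ⟨e, he, by rw [h2, Finset.pair_comm]⟩⟩⟩
  loopless := ⟨fun a h => h.1 rfl⟩

/-- A shortest odd closed walk is a cycle. -/
lemma exists_odd_cycle {V : Type*} (G : SimpleGraph V)
    (h : ¬ G.Colorable 2) : ∃ (m : ℕ) (g : ℕ → V), g (2 * m + 3) = g 0 ∧
      (∀ k < 2 * m + 3, G.Adj (g k) (g (k + 1))) ∧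
      (∀ i < 2 * m + 3, ∀ j < 2 * m + 3, g i = g j → i = j) := by
  classical
  have hex : ∃ L : ℕ, Odd L ∧ ∃ g : ℕ → V, g L = g 0 ∧
      ∀ k < L, G.Adj (g k) (g (k + 1)) := by
    rw [SimpleGraph.two_colorable_iff_forall_loop_even] at h
    push Not at h
    obtain ⟨u, w, hw⟩ := h
    refine ⟨w.length, by simpa using hw, w.getVert, by simp, ?_⟩
    intro k hk
    exact w.adj_getVert_succ hk
  obtain ⟨hodd, g, hg, hadj⟩ := Nat.find_spec hex
  have hmin := fun L' (hL' : L' < Nat.find hex) => Nat.find_min hex hL'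
  generalize Nat.find hex = L at *
  have key : ∀ i j, i < j → j < L → g i ≠ g j := by
    intro i j hij hj heq
    rcases Nat.even_or_odd (j - i) with hev | hod
    · apply hmin (L - (j - i)) (by omega)
      refine ⟨by grind, fun k => if k ≤ i then g k else g (k + (j - i)), ?_, ?_⟩
      · have h1 : ¬ (L - (j - i) ≤ i) := by omega
        have h2 : L - (j - i) + (j - i) = L := by omega
        simp [h1, h2, hg]
      · intro k hk
        rcases lt_trichotomy k i with h1 | h1 | h1
        · have h2 : k ≤ i := by omega
          have h3 : k + 1 ≤ i := by omega
          simpa [h2, h3] using hadj k (by omega)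
        · subst h1
          have h3 : k + 1 + (j - k) = j + 1 := by omega
          simp [h3, heq]
          exact hadj j hj
        · have h2 : ¬ k ≤ i := by omega
          have h3 : ¬ k + 1 ≤ i := by omega
          have h4 : k + 1 + (j - i) = k + (j - i) + 1 := by omega
          simp only [h2, h3, h4, if_false]
          exact hadj _ (by omega)
    · apply hmin (j - i) (by omega)
      refine ⟨hod, fun k => g (i + k), ?_, ?_⟩
      · have : i + (j - i) = j := by omega
        simp [this, heq]
      · intro k hk
        exact hadj (i + k) (by omega)
  have h3 : ∃ m, L = 2 * m + 3 := by
    obtain ⟨r, hr⟩ := hodd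
    rcases r with _ | r
    · exfalso
      subst hr
      have := hadj 0 (by omega)
      simp at hg this
      rw [hg] at this
      exact G.loopless.irrefl _ this
    · exact ⟨r, by omega⟩
  obtain ⟨m, rfl⟩ := h3
  refine ⟨m, g, hg, hadj, ?_⟩
  intro i hi j hj hgij
  rcases lt_trichotomy i j with h1 | h1 | h1
  · exact absurd hgij (key i j h1 hj)
  · exact h1
  · exact absurd hgij.symm (key j i h1 hi)

lemma traceGraph_colorable {V : Type*} [DecidableEq V] (E : Finset (Finset V))
    (hbal : IsBalanced E) (W : Finset V) : (traceGraph E W).Colorable 2 := by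
  by_contra hcon
  obtain ⟨m, g, hg, hadj, hinj⟩ := exists_odd_cycle _ hcon
  set v : Fin (2 * m + 3) → V := fun i => g i.val with hv
  have hvinj : Function.Injective v := fun i j hij =>
    Fin.ext (hinj _ i.isLt _ j.isLt hij)
  have hvs : ∀ i : Fin (2 * m + 3), v (i + 1) = g (i.val + 1) := by
    intro i
    rcases eq_or_ne i (Fin.last _) with rfl | hi
    · simp [hv, hg]
    · simp only [hv]
      rw [Fin.val_add_one_of_lt (Fin.lt_last_iff_ne_last.2 hi)]
  have hA : ∀ i : Fin (2 * m + 3), ∃ e ∈ E, e ∩ W = {v i, v (i + 1)} := by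
    intro i
    rw [hvs]
    exact (hadj i.val i.isLt).2
  choose e heE heW using hA
  have hmem : ∀ i, v i ∈ e i ∩ W ∧ v (i + 1) ∈ e i ∩ W := by
    intro i; rw [heW]; simp
  have hW : ∀ i, v i ∈ W := fun i => (Finset.mem_inter.1 (hmem i).1).2
  have hmem' : ∀ t j, v j ∈ e t → j = t ∨ j = t + 1 := by
    intro t j hj
    have : v j ∈ e t ∩ W := Finset.mem_inter.2 ⟨hj, hW j⟩
    rw [heW] at this
    simpa [hvinj.eq_iff] using this
  have heinj : Function.Injective e := by
    intro i j hij
    have h1 := hmem' j i (hij ▸ (Finset.mem_inter.1 (hmem i).1).1)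
    have h2 := hmem' i j (hij ▸ (Finset.mem_inter.1 (hmem j).1).1)
    rcases h1 with h1 | h1
    · exact h1
    rcases h2 with h2 | h2
    · exact h2.symm
    exfalso
    rw [h2, add_assoc] at h1
    have h3 : (1 + 1 : Fin (2 * m + 3)) = 0 := by simpa using h1
    have := congrArg Fin.val h3
    simp [Fin.val_add] at this
    rw [Nat.mod_eq_of_lt (by omega)] at this
    omega
  obtain ⟨t, ht⟩ := hbal m v e hvinj heinj heE fun i =>
    ⟨(Finset.mem_inter.1 (hmem i).1).1, (Finset.mem_inter.1 (hmem i).2).1⟩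
  have : (Finset.univ.filter fun j => v j ∈ e t) ⊆ {t, t + 1} := by
    intro j hj
    simpa using hmem' t j (by simpa using hj)
  have := (Finset.card_le_card this).trans Finset.card_le_two
  omega

lemma exists_two_coloring {V : Type*} [DecidableEq V] (E : Finset (Finset V))
    (hbal : IsBalanced E) (W : Finset V) : ∃ c : V → Bool, ∀ e ∈ E, 2 ≤ (e ∩ W).card →
      ∃ a ∈ e ∩ W, ∃ b ∈ e ∩ W, c a ≠ c b := by
  classical
  induction hN : W.card generalizing W with
  | zero =>
    rw [Finset.card_eq_zero] at hN
    subst hN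
    exact ⟨fun _ => true, fun e _ h => by simp at h⟩
  | succ N ih =>
    obtain ⟨r, hr⟩ : W.Nonempty := by
      rw [← Finset.card_pos]; omega
    set G := traceGraph E W with hG
    obtain ⟨b⟩ := traceGraph_colorable E hbal W
    have hGW : ∀ a b, G.Adj a b → a ∈ W ∧ b ∈ W := by
      rintro a b ⟨_, e, he, h⟩
      have h1 : a ∈ e ∩ W := by rw [h]; simp
      have h2 : b ∈ e ∩ W := by rw [h]; simp
      exact ⟨(Finset.mem_inter.1 h1).2, (Finset.mem_inter.1 h2).2⟩
    obtain ⟨x, hx, hmax⟩ := Finset.exists_max_image (W.filter fun y => G.Reachable r y)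
      (fun y => G.dist r y) ⟨r, by simp [hr]⟩
    rw [Finset.mem_filter] at hx
    obtain ⟨c, hc⟩ := ih (W.erase x) (by rw [Finset.card_erase_of_mem hx.1]; omega)
    have hcG : ∀ u w, G.Adj u w → u ≠ x → w ≠ x → c u ≠ c w := by
      rintro u w ⟨huw, e, he, h⟩ hux hwx
      have h' : e ∩ W.erase x = {u, w} := by
        rw [← Finset.erase_inter_comm, Finset.inter_comm, Finset.inter_erase,
          Finset.inter_comm, h]
        apply Finset.erase_eq_of_notMem
        simp [hux.symm, hwx.symm]
      obtain ⟨a, ha, a', ha', hne⟩ := hc e he (by rw [h', Finset.card_pair huw])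
      rw [h'] at ha ha'
      simp only [Finset.mem_insert, Finset.mem_singleton] at ha ha'
      rcases ha with rfl | rfl <;> rcases ha' with rfl | rfl
      · exact absurd rfl hne
      · exact hne
      · exact hne.symm
      · exact absurd rfl hne
    have hclaim : ∀ d u, G.Reachable r u → G.dist r u = d → u ≠ x →
        ((c u = c r) ↔ (b u = b r)) := by
      intro d
      induction d with
      | zero =>
        intro u hu hd _
        rw [hu.dist_eq_zero_iff] at hd
        subst hd
        simp
      | succ d ihd =>
        intro u hu hd hux
        obtain ⟨p, hp⟩ := hu.symm.exists_walk_length_eq_dist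
        rw [SimpleGraph.dist_comm, hd] at hp
        cases p with
        | nil => simp at hp
        | @cons _ w _ hadj q =>
          have hq : q.length = d := by simpa using hp
          have hrw : G.Reachable r w := q.reachable.symm
          have hle : G.dist r w ≤ d := by
            rw [SimpleGraph.dist_comm, ← hq]; exact SimpleGraph.dist_le q
          have hge : d + 1 ≤ G.dist r w + 1 := by
            rw [← hd]
            have := hadj.symm.reachable.dist_triangle_right r
            rwa [SimpleGraph.dist_eq_one_iff_adj.2 hadj.symm] at this
          have hux' := hmax u (by simp [(hGW _ _ hadj).1, hu])
          have hwx : w ≠ x := by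
            rintro rfl
            omega
          have h1 := ihd w hrw (by omega) hwx
          have h2 := hcG u w hadj hux hwx
          have h3 := b.valid hadj
          clear * - h1 h2 h3
          generalize c u = cu at *
          generalize c w = cw at *
          generalize c r = cr at *
          generalize b u = bu at *
          generalize b w = bw at *
          generalize b r = br at *
          revert cu cw cr bu bw br
          decide
    have hnb : ∀ y z, G.Adj x y → G.Adj x z → c y = c z := by
      intro y z hy hz
      have h1 := hclaim _ y (hx.2.trans hy.reachable) rfl hy.ne'
      have h2 := hclaim _ z (hx.2.trans hz.reachable) rfl hz.ne'
      have h3 := b.valid hy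
      have h4 := b.valid hz
      clear * - h1 h2 h3 h4
      generalize c y = cu at *
      generalize c z = cw at *
      generalize c r = cr at *
      generalize b y = bu at *
      generalize b z = bw at *
      generalize b r = br at *
      generalize b x = bx at *
      revert cu cw cr bu bw br bx
      decide
    obtain ⟨col, hcol⟩ : ∃ col : Bool, ∀ y, G.Adj x y → c y ≠ col := by
      by_cases h : ∃ y, G.Adj x y
      · obtain ⟨y, hy⟩ := h
        refine ⟨!(c y), fun z hz => ?_⟩
        rw [hnb z y hz hy]
        simp
      · push Not at h
        exact ⟨true, fun y hy => absurd hy (h y)⟩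
    refine ⟨Function.update c x col, fun e he hcard => ?_⟩
    have hsub : e ∩ W.erase x = (e ∩ W).erase x := by
      ext; simp; tauto
    by_cases h2 : 2 ≤ (e ∩ W.erase x).card
    · obtain ⟨a, ha, a', ha', hne⟩ := hc e he h2
      rw [hsub, Finset.mem_erase] at ha ha'
      exact ⟨a, ha.2, a', ha'.2, by simpa [ha.1, ha'.1] using hne⟩
    · by_cases hxe : x ∈ e ∩ W
      · rw [hsub, Finset.card_erase_of_mem hxe] at h2
        have h3 : (e ∩ W).card = 2 := by omega
        have h4 : ((e ∩ W).erase x).card = 1 := by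
          rw [Finset.card_erase_of_mem hxe]; omega
        obtain ⟨y, hy⟩ := Finset.card_eq_one.1 h4
        have hy' : y ∈ (e ∩ W).erase x := by rw [hy]; simp
        rw [Finset.mem_erase] at hy'
        have hadj : G.Adj x y := ⟨hy'.1.symm, e, he, by
          rw [← hy, Finset.insert_erase hxe]⟩
        refine ⟨x, hxe, y, hy'.2, ?_⟩
        simpa [hy'.1] using (hcol y hadj).symm
      · rw [hsub, Finset.erase_eq_of_notMem hxe] at h2
        exact absurd hcard h2

lemma exists_good_coloring {V : Type*} [DecidableEq V] [Fintype V] (E : Finset (Finset V))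
    (hbal : IsBalanced E) (k : ℕ) (hk : 1 ≤ k) : ∃ χ : V → Fin k, ∀ e ∈ E, k ≤ e.card →
      ∀ q, ∃ v ∈ e, χ v = q := by
  classical
  have : Nonempty (Fin k) := ⟨⟨0, hk⟩⟩
  obtain ⟨χ, hχ⟩ := Finite.exists_max (fun χ : V → Fin k => ∑ e ∈ E, (e.image χ).card)
  refine ⟨χ, fun e he hek q => ?_⟩
  by_contra hq
  push Not at hq
  have hlt : (e.image χ).card < e.card := by
    refine lt_of_lt_of_le ?_ hek
    have : (e.image χ) ⊂ Finset.univ := by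
      rw [Finset.ssubset_univ_iff]
      intro h
      have : q ∈ e.image χ := by rw [h]; simp
      obtain ⟨v, hv, h⟩ := Finset.mem_image.1 this
      exact hq v hv h
    simpa using Finset.card_lt_card this
  obtain ⟨a, ha, a', ha', hne, heq⟩ := Finset.exists_ne_map_eq_of_card_lt_of_maps_to hlt
    (fun v hv => Finset.mem_image_of_mem χ hv)
  set p := χ a with hp
  have hpq : p ≠ q := hq a ha
  set W : Finset V := Finset.univ.filter fun v => χ v = p ∨ χ v = q with hW
  obtain ⟨c, hc⟩ := exists_two_coloring E hbal W
  set χ' : V → Fin k := fun v => if v ∈ W then (if c v then p else q) else χ v with hχ'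
  have hsplit : ∀ (ψ : V → Fin k), (∀ v, v ∈ W ↔ (ψ v = p ∨ ψ v = q)) → ∀ e : Finset V,
      (e.image ψ).card = ((e ∩ W).image ψ).card + ((e \ W).image ψ).card := by
    intro ψ hψ e
    rw [← Finset.card_union_of_disjoint, ← Finset.image_union, Finset.union_comm,
      Finset.sdiff_union_inter]
    rw [Finset.disjoint_left]
    intro z hz hz'
    simp only [Finset.mem_image, Finset.mem_inter, Finset.mem_sdiff] at hz hz'
    obtain ⟨v, ⟨_, hv⟩, rfl⟩ := hz
    obtain ⟨w, ⟨_, hw⟩, hvw⟩ := hz'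
    rw [hψ] at hv hw
    rw [hvw] at hw
    exact hw hv
  have h1 := hsplit χ (by simp [hW])
  have h2 := hsplit χ' (by
    intro v
    by_cases hv : v ∈ W
    · simp only [hχ', hv, if_true, true_iff]
      split_ifs <;> simp
    · simp only [hχ', hv, if_false, false_iff]
      simpa [hW] using hv)
  have h3 : ∀ e : Finset V, (e \ W).image χ' = (e \ W).image χ := by
    intro e
    apply Finset.image_congr
    intro v hv
    have : v ∉ W := (Finset.mem_sdiff.1 (Finset.mem_coe.1 hv)).2
    simp [hχ', this]
  have h4 : ∀ e ∈ E, 2 ≤ (e ∩ W).card → 2 ≤ ((e ∩ W).image χ').card := by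
    intro e he h
    obtain ⟨u, hu, w, hw, huw⟩ := hc e he h
    have : χ' u ≠ χ' w := by
      simp only [hχ', (Finset.mem_inter.1 hu).2, (Finset.mem_inter.1 hw).2, if_true]
      cases hcu : c u <;> cases hcw : c w <;> simp [hcu, hcw, hpq, hpq.symm] at huw ⊢
    exact Finset.one_lt_card.2 ⟨_, Finset.mem_image_of_mem _ hu, _,
      Finset.mem_image_of_mem _ hw, this⟩
  have h5 : ∀ e : Finset V, ((e ∩ W).image χ).card ≤ 2 := by
    intro e
    refine (Finset.card_le_card (t := {p, q}) ?_).trans Finset.card_le_two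
    intro z hz
    obtain ⟨v, hv, rfl⟩ := Finset.mem_image.1 hz
    have := (Finset.mem_inter.1 hv).2
    simpa [hW] using this
  have hle : ∀ e ∈ E, (e.image χ).card ≤ (e.image χ').card := by
    intro e he
    rw [h1, h2, h3]
    refine Nat.add_le_add_right ?_ _
    by_cases h : 2 ≤ (e ∩ W).card
    · exact (h5 e).trans (h4 e he h)
    · refine Finset.card_image_le.trans ?_
      rcases Finset.eq_empty_or_nonempty (e ∩ W) with h0 | h0
      · simp [h0]
      · have := Finset.card_pos.2 (h0.image χ')
        omega
  have haW : a ∈ e ∩ W := by simp [hW, ha, hp]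
  have haW' : a' ∈ e ∩ W := by simp [hW, ha', ← heq]
  have hstrict : (e.image χ).card < (e.image χ').card := by
    rw [h1, h2, h3]
    refine Nat.add_lt_add_right ?_ _
    have h6 : ((e ∩ W).image χ).card ≤ 1 := by
      refine (Finset.card_le_card (t := {p}) ?_).trans (by simp)
      intro z hz
      obtain ⟨v, hv, rfl⟩ := Finset.mem_image.1 hz
      have h7 := Finset.mem_inter.1 hv
      have h8 : χ v = p ∨ χ v = q := by simpa [hW] using h7.2
      rcases h8 with h8 | h8
      · simp [h8]
      · exact absurd h8 (hq v h7.1)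
    have h9 := h4 e he (Finset.one_lt_card.2 ⟨a, haW, a', haW', hne⟩)
    omega
  exact absurd (hχ χ') (not_le.2 (Finset.sum_lt_sum hle ⟨e, he, hstrict⟩))

/-- Blow-up of a balanced hypergraph. -/
lemma isBalanced_blowup {n : ℕ} (E : Finset (Finset (Fin n))) (hbal : IsBalanced E)
    (β : Fin n → ℕ) :
    IsBalanced (E.image fun e => e.sigma fun i => (Finset.univ : Finset (Fin (β i)))) := by
  classical
  intro m v e' hv he' hE hinc
  have : ∀ i, ∃ e ∈ E, (e.sigma fun i => (Finset.univ : Finset (Fin (β i)))) = e' i := by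
    intro i; simpa using hE i
  choose e heE hee using this
  have hmem : ∀ j t, v j ∈ e' t ↔ (v j).1 ∈ e t := by
    intro j t; rw [← hee]; simp
  by_cases hinj : Function.Injective fun i => (v i).1
  · obtain ⟨t, ht⟩ := hbal m (fun i => (v i).1) e hinj
      (fun i j hij => he' (by rw [← hee, ← hee, hij])) heE
      (fun i => by simpa only [hmem] using hinc i)
    exact ⟨t, by simpa only [hmem] using ht⟩
  · have two_ne : ∀ j : Fin (2 * m + 3), j + 1 + 1 ≠ j := by
      intro j h
      rw [add_assoc] at h
      have h3 : (1 + 1 : Fin (2 * m + 3)) = 0 := by simpa using h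
      have := congrArg Fin.val h3
      simp [Fin.val_add] at this
      rw [Nat.mod_eq_of_lt (by omega)] at this
      omega
    have one_ne : ∀ j : Fin (2 * m + 3), j + 1 ≠ j := by
      intro j h
      simp at h
    have three : ∀ t a b c, a ≠ b → a ≠ c → b ≠ c → v a ∈ e' t → v b ∈ e' t → v c ∈ e' t →
        3 ≤ (Finset.univ.filter fun j => v j ∈ e' t).card := by
      intro t a b c hab hac hbc ha hb hc
      have : ({a, b, c} : Finset _) ⊆ Finset.univ.filter fun j => v j ∈ e' t := by
        intro z hz
        simp only [Finset.mem_insert, Finset.mem_singleton] at hz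
        rcases hz with rfl | rfl | rfl <;> simpa
      have h := Finset.card_le_card this
      rwa [Finset.card_eq_three.2 ⟨a, b, c, hab, hac, hbc, rfl⟩] at h
    simp only [Function.Injective] at hinj
    push Not at hinj
    obtain ⟨j, k, hjk, hne⟩ := hinj
    by_cases hk : k = j + 1
    · refine ⟨k, three k j k (k + 1) hne ?_ (one_ne k).symm ?_ (hinc k).1 (hinc k).2⟩
      · rw [hk]; exact (two_ne j).symm
      · rw [hmem, hjk, ← hmem]; exact (hinc k).1
    · refine ⟨j, three j j (j + 1) k (one_ne j).symm hne (Ne.symm hk) (hinc j).1 (hinc j).2 ?_⟩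
      rw [hmem, ← hjk, ← hmem]; exact (hinc j).1

lemma exists_minVertexCover {n : ℕ} (E : Finset (Finset (Fin n))) (τ : Finset (Fin n))
    (h : IsVertexCover E τ) : ∃ τ' ⊆ τ, IsMinVertexCover E τ' := by
  induction τ using Finset.strongInduction with
  | H τ ih =>
    by_cases hm : ∀ τ' ⊂ τ, ¬ IsVertexCover E τ'
    · exact ⟨τ, subset_rfl, h, hm⟩
    · push Not at hm
      obtain ⟨τ', h1, h2⟩ := hm
      obtain ⟨τ'', h3, h4⟩ := ih τ' h1 h2
      exact ⟨τ'', h3.trans h1.1, h4⟩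

lemma monomial_mem_pow {n : ℕ} (K : Type*) [Field K] (E : Finset (Finset (Fin n)))
    (hbal : IsBalanced E) (β : Fin n → ℕ) (s : ℕ) (hs : 1 ≤ s)
    (h : ∀ e ∈ E, s ≤ ∑ i ∈ e, β i) :
    (∏ i, X i ^ β i : MvPolynomial (Fin n) K) ∈ (coverIdeal K E) ^ s := by
  classical
  obtain ⟨χ, hχ⟩ := exists_good_coloring _ (isBalanced_blowup E hbal β) s hs
  have hcov : ∀ q : Fin s, IsVertexCover E (Finset.univ.filter fun i => ∃ c, χ ⟨i, c⟩ = q) := by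
    intro q e he
    obtain ⟨⟨i, c⟩, hv, hvq⟩ := hχ _ (Finset.mem_image_of_mem _ he)
      (by simpa [Finset.card_sigma] using h e he) q
    exact ⟨i, by simpa using hv, by simpa using ⟨c, hvq⟩⟩
  choose τ hτ hmin using fun q => exists_minVertexCover E _ (hcov q)
  have hprod : (∏ q : Fin s, ∏ i ∈ τ q, (X i : MvPolynomial (Fin n) K)) ∈
      (coverIdeal K E) ^ s := by
    have := Ideal.prod_mem_prod (s := (Finset.univ : Finset (Fin s)))
      (I := fun _ => coverIdeal K E) (x := fun q => ∏ i ∈ τ q, (X i : MvPolynomial (Fin n) K))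
      (fun q _ => Ideal.subset_span ⟨τ q, hmin q, rfl⟩)
    simpa using this
  refine Ideal.mem_of_dvd _ ?_ hprod
  have : (∏ q : Fin s, ∏ i ∈ τ q, (X i : MvPolynomial (Fin n) K)) =
      ∏ i, X i ^ (Finset.univ.filter fun q => i ∈ τ q).card := by
    have : ∀ q : Fin s, ∏ i ∈ τ q, (X i : MvPolynomial (Fin n) K) =
        ∏ i, if i ∈ τ q then X i else 1 := by
      intro q; simp
    simp_rw [this]
    rw [Finset.prod_comm]
    refine Finset.prod_congr rfl fun i _ => ?_
    rw [← Finset.prod_filter, Finset.prod_const]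
  rw [this]
  refine Finset.prod_dvd_prod_of_dvd _ _ fun i _ => pow_dvd_pow _ ?_
  have hsub : (Finset.univ.filter fun q => i ∈ τ q) ⊆
      (Finset.univ : Finset (Fin (β i))).image fun c => χ ⟨i, c⟩ := by
    intro q hq
    have := hτ q (by simpa using hq)
    simpa using this
  refine (Finset.card_le_card hsub).trans (Finset.card_image_le.trans ?_)
  simp

/-- For a balanced hypergraph `H` on `{1,…,n}`, `α ∈ ℕⁿ` and `s ≥ 1`, the degree complex
`Δ_α(J(H)^s)` is generated by the sets `V \ e` over the edges `e ∈ E` with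
`∑_{i ∈ e} α_i ≤ s − 1`. -/
theorem degreeComplex_coverIdeal_pow_of_balanced {n : ℕ} (K : Type*) [Field K]
    (E : Finset (Finset (Fin n))) (hbal : IsBalanced E)
    (α : Fin n → ℕ) (s : ℕ) (hs : 1 ≤ s) :
    degreeComplex ((coverIdeal K E) ^ s) α =
      {σ : Finset (Fin n) | ∃ e ∈ E, σ ⊆ Finset.univ \ e ∧ ∑ i ∈ e, α i ≤ s - 1} := by
  classical
  ext F
  simp only [degreeComplex, Set.mem_ofPred_eq]
  constructor
  · intro hF
    by_contra hcon
    push Not at hcon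
    apply hF
    refine ⟨s, ?_⟩
    have hmono : (∏ i, X i ^ α i : MvPolynomial (Fin n) K) * (∏ i ∈ F, X i) ^ s =
        ∏ i, X i ^ (α i + if i ∈ F then s else 0) := by
      have : (∏ i ∈ F, X i : MvPolynomial (Fin n) K) ^ s =
          ∏ i, X i ^ (if i ∈ F then s else 0) := by
        rw [← Finset.prod_pow]
        simp [pow_ite]
      rw [this, ← Finset.prod_mul_distrib]
      simp_rw [pow_add]
    rw [hmono]
    apply monomial_mem_pow K E hbal _ s hs
    intro e he
    by_cases hd : F ⊆ Finset.univ \ e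
    · have h1 := hcon e he hd
      have h2 : ∑ i ∈ e, α i ≤ ∑ i ∈ e, (α i + if i ∈ F then s else 0) :=
        Finset.sum_le_sum fun i _ => Nat.le_add_right _ _
      omega
    · obtain ⟨i, hiF, hie⟩ := Finset.not_subset.1 hd
      have hie' : i ∈ e := by simpa using hie
      have := Finset.single_le_sum (f := fun i => α i + if i ∈ F then s else 0)
        (fun i _ => Nat.zero_le _) hie'
      simp only [hiF, if_true] at this
      omega
  · rintro ⟨e, he, hFe, hsum⟩ ⟨k, hk⟩
    set φ : MvPolynomial (Fin n) K →ₐ[K] Polynomial K :=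
      aeval fun i => if i ∈ e then Polynomial.X else 1 with hφ
    have hJ : (coverIdeal K E).map φ ≤ Ideal.span {(Polynomial.X : Polynomial K)} := by
      rw [coverIdeal, Ideal.map_span, Ideal.span_le]
      rintro _ ⟨_, ⟨τ, hτ, rfl⟩, rfl⟩
      obtain ⟨i, hi, hiτ⟩ := hτ.1 e he
      rw [SetLike.mem_coe, Ideal.mem_span_singleton]
      have : (φ (∏ i ∈ τ, X i)) = ∏ i ∈ τ, if i ∈ e then (Polynomial.X : Polynomial K) else 1 := by
        simp [hφ]
      change _ ∣ φ _
      rw [this]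
      refine dvd_trans ?_ (Finset.dvd_prod_of_mem _ hiτ)
      simp [hi]
    have h1 := Ideal.mem_map_of_mem φ hk
    rw [Ideal.map_pow] at h1
    have h2 := Ideal.pow_right_mono hJ s h1
    rw [Ideal.span_singleton_pow, Ideal.mem_span_singleton] at h2
    have h3 : φ ((∏ i, X i ^ α i) * (∏ i ∈ F, X i) ^ k) =
        Polynomial.X ^ (∑ i ∈ e, α i) := by
      have hF1 : φ (∏ i ∈ F, X i) = 1 := by
        rw [map_prod]
        refine Finset.prod_eq_one fun i hi => ?_
        have : i ∉ e := by simpa using hFe hi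
        simp [hφ, this]
      rw [map_mul, map_pow, hF1, one_pow, mul_one, map_prod, ← Finset.prod_pow_eq_pow_sum]
      simp [hφ, ite_pow, Finset.prod_ite_mem]
    rw [h3, pow_dvd_pow_iff Polynomial.X_ne_zero Polynomial.not_isUnit_X] at h2
    omega
end

section
/- Let E_1,...,E_m be subsets of {1,...,n}, 1 ≤ r ≤ m, and let C̄_1 ⊆ ℝ^n be the solution set of: ∑_{i∈E_j} x_i ≤ 1 for j = 1,...,r; ∑_{i∈E_j} x_i ≥ 1 for j = r+1,...,m; x_i ≥ 0 for all i. If the incidence matrix of the hypergraph with edges E_1,...,E_m is balanced and C̄_1 is nonempty and bounded, then every vertex (extreme point) of the polytope C̄_1 has all coordinates in {0,1}; in particular every vertex is an integer point. -/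
/-- A 0-1 matrix is balanced if it contains no square submatrix of odd order `k ≥ 3`
(`k = 2l+3`) equal to the cyclic matrix `B_k` with two consecutive 1's per row. -/
def IsBalancedMatrix {R C : Type*} (A : Matrix R C ℝ) : Prop :=
  ∀ (l : ℕ) (ρ : Fin (2 * l + 3) → R) (c : Fin (2 * l + 3) → C),
    Function.Injective ρ → Function.Injective c →
    ¬ (∀ i j, A (ρ i) (c j) = if j = i ∨ j = i + 1 then 1 else 0)

/-- The incidence matrix of the hypergraph with edges `E_1,…,E_m`. -/
def incidenceMatrix {n m : ℕ} (E : Fin m → Finset (Fin n)) : Matrix (Fin m) (Fin n) ℝ :=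
  fun j i => if i ∈ E j then 1 else 0

/-- The closed set `C̄₁`. -/
def closedSetC1 {n m : ℕ} (E : Fin m → Finset (Fin n)) (r : ℕ) : Set (Fin n → ℝ) :=
  {x | (∀ i, 0 ≤ x i) ∧
    ∀ j : Fin m, ((j : ℕ) < r → ∑ i ∈ E j, x i ≤ 1) ∧ (r ≤ (j : ℕ) → 1 ≤ ∑ i ∈ E j, x i)}

/-- Set-family version of balancedness. -/
def BalFam {R C : Type*} (E : R → Finset C) : Prop :=
  ∀ (l : ℕ) (ρ : Fin (2 * l + 3) → R) (c : Fin (2 * l + 3) → C),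
    Function.Injective ρ → Function.Injective c →
    ¬ (∀ i j, c j ∈ E (ρ i) ↔ (j = i ∨ j = i + 1))

lemma fin_add_one_val (l : ℕ) (j : Fin (2 * l + 3)) :
    (j + 1).val = if j.val = 2 * l + 2 then 0 else j.val + 1 := by
  have := Fin.val_add_one j
  simp only [this, Fin.ext_iff, Fin.val_last]

lemma fin_two_ne (l : ℕ) (j : Fin (2 * l + 3)) : j + 1 + 1 ≠ j := by
  intro h
  have h2 := congrArg Fin.val h
  have hj := j.2
  rw [fin_add_one_val, fin_add_one_val] at h2
  split_ifs at h2 <;> omega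

/-- No odd cycle of traces of size two. -/
lemma no_cycle {R C : Type*} [DecidableEq C] (E : R → Finset C) (hb : BalFam E)
    (W : Finset C) (l : ℕ) (c : Fin (2 * l + 3) → C) (hc : Function.Injective c)
    (h : ∀ t, ∃ j, E j ∩ W = {c t, c (t + 1)}) (hW : ∀ t, c t ∈ W) : False := by
  choose ρ hρ using h
  have key : ∀ i j, c j ∈ E (ρ i) ↔ (j = i ∨ j = i + 1) := by
    intro i j
    have : c j ∈ E (ρ i) ↔ c j ∈ E (ρ i) ∩ W := by simp [hW]
    rw [this, hρ]
    simp [hc.eq_iff]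
  refine hb l ρ c ?_ hc key
  intro a b hab
  have h1 := key a
  rw [hab] at h1
  have ha := (key b a).1 ((h1 a).2 (Or.inl rfl))
  have hb' := (h1 b).1 ((key b b).2 (Or.inl rfl))
  rcases ha with ha | ha
  · exact ha
  · rcases hb' with hb' | hb'
    · exact hb'.symm
    · exact absurd (by rw [← ha, ← hb'] : b + 1 + 1 = b) (fin_two_ne l b)

/-- The two-element-trace relation. -/
def TwoAdj {R C : Type*} [DecidableEq C] (E : R → Finset C) (W : Finset C) (u v : C) : Prop :=
  u ≠ v ∧ ∃ j, E j ∩ W = {u, v}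

lemma TwoAdj.symm {R C : Type*} [DecidableEq C] {E : R → Finset C} {W : Finset C} {u v : C}
    (h : TwoAdj E W u v) : TwoAdj E W v u := by
  obtain ⟨h1, j, h2⟩ := h
  exact ⟨h1.symm, j, by rw [h2, Finset.pair_comm]⟩

lemma TwoAdj.mem {R C : Type*} [DecidableEq C] {E : R → Finset C} {W : Finset C} {u v : C}
    (h : TwoAdj E W u v) : u ∈ W := by
  obtain ⟨h1, j, h2⟩ := h
  have : u ∈ E j ∩ W := by rw [h2]; simp
  exact (Finset.mem_inter.1 this).2

/-- Simple paths, of `k` edges. -/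
def PathOf {R C : Type*} [DecidableEq C] (E : R → Finset C) (W : Finset C) (k : ℕ)
    (f : ℕ → C) : Prop :=
  (∀ s ≤ k, f s ∈ W) ∧ (∀ s ≤ k, ∀ t ≤ k, f s = f t → s = t) ∧
    ∀ s < k, TwoAdj E W (f s) (f (s + 1))

lemma exists_max_path {R C : Type*} [DecidableEq C] (E : R → Finset C) (W : Finset C)
    (hW : W.Nonempty) : ∃ k f, PathOf E W k f ∧
      ∀ u, TwoAdj E W (f 0) u → ∃ s, 1 ≤ s ∧ s ≤ k ∧ f s = u := by
  classical
  obtain ⟨w, hw⟩ := hW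
  have h0 : ∃ f, PathOf E W 0 f := ⟨fun _ => w, fun _ _ => hw, by intros; omega, by intros; omega⟩
  have hbd : ∀ k, (∃ f, PathOf E W k f) → k ≤ W.card := by
    rintro k ⟨f, h1, h2, -⟩
    have : (Finset.range (k + 1)).card ≤ W.card := by
      apply Finset.card_le_card_of_injOn f
      · intro s hs
        simp at hs
        exact h1 s (by omega)
      · intro s hs t ht hst
        simp at hs ht
        exact h2 s (by omega) t (by omega) hst
    simp at this
    omega
  set K := Nat.findGreatest (fun k => ∃ f, PathOf E W k f) W.card with hK
  have hKs : ∃ f, PathOf E W K f :=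
    Nat.findGreatest_spec (P := fun k => ∃ f, PathOf E W k f) (Nat.zero_le _) h0
  obtain ⟨f, hf⟩ := hKs
  refine ⟨K, f, hf, ?_⟩
  intro u hu
  by_contra hcon
  push Not at hcon
  have hnew : ∃ f, PathOf E W (K + 1) f := by
    obtain ⟨h1, h2, h3⟩ := hf
    have hne : ∀ s ≤ K, f s ≠ u := by
      intro s hs
      rcases Nat.eq_zero_or_pos s with rfl | hs'
      · exact hu.1
      · exact hcon s hs' hs
    refine ⟨fun s => Nat.casesOn s u f, ?_, ?_, ?_⟩
    · rintro (_ | s) hs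
      · exact hu.symm.mem
      · exact h1 s (by omega)
    · rintro (_ | s) hs (_ | t) ht hst
      · rfl
      · exact absurd hst.symm (hne t (by omega))
      · exact absurd hst (hne s (by omega))
      · rw [h2 s (by omega) t (by omega) hst]
    · rintro (_ | s) hs
      · exact hu.symm
      · exact h3 s (by omega)
  have := Nat.le_findGreatest (P := fun k => ∃ f, PathOf E W k f) (hbd _ hnew) hnew
  omega

lemma no_odd_closure {R C : Type*} [DecidableEq C] (E : R → Finset C) (hb : BalFam E)
    (W : Finset C) (k : ℕ) (f : ℕ → C) (hf : PathOf E W k f) (i l : ℕ) (hi : 1 ≤ i)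
    (hl : i + (2 * l + 1) ≤ k) (ha : TwoAdj E W (f 0) (f i))
    (hb' : TwoAdj E W (f 0) (f (i + (2 * l + 1)))) : False := by
  obtain ⟨h1, h2, h3⟩ := hf
  refine no_cycle E hb W l (fun t => f (if t.val = 2 * l + 2 then 0 else i + t.val)) ?_ ?_ ?_
  · intro s t hst
    have hs := s.2
    have ht := t.2
    have := h2 _ (by split_ifs <;> omega) _ (by split_ifs <;> omega) hst
    ext
    split_ifs at this <;> omega
  · intro t
    have ht := t.2
    simp only [fin_add_one_val]
    by_cases e1 : t.val = 2 * l + 2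
    · simpa [e1] using ha.2
    · by_cases e2 : t.val = 2 * l + 1
      · simpa [e2] using hb'.symm.2
      · have e3 : ¬ (t.val + 1 = 2 * l + 2) := by omega
        simpa [e1, e2, e3, add_assoc] using (h3 (i + t.val) (by omega)).2
  · intro t
    have ht := t.2
    exact h1 _ (by split_ifs <;> omega)

/-- Balanced families are bicolorable. -/
lemma bicolor {R C : Type*} [DecidableEq C] (E : R → Finset C) (hb : BalFam E) :
    ∀ (N : ℕ) (W : Finset C), W.card = N → ∃ h : C → Bool, ∀ j, 2 ≤ (E j ∩ W).card →
      ∀ b, ∃ c ∈ E j ∩ W, h c = b := by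
  intro N
  induction N with
  | zero =>
    intro W hW
    refine ⟨fun _ => true, fun j hj => ?_⟩
    rw [Finset.card_eq_zero] at hW
    simp [hW] at hj
  | succ N ih =>
    intro W hW
    obtain ⟨k, f, hf, hmax⟩ := exists_max_path E W (by
      rw [← Finset.card_pos]; omega)
    have hv : f 0 ∈ W := hf.1 0 (Nat.zero_le _)
    obtain ⟨h, hh⟩ := ih (W.erase (f 0)) (by rw [Finset.card_erase_of_mem hv]; omega)
    -- proper along edges avoiding `f 0`
    have hprop : ∀ u v, TwoAdj E W u v → u ≠ f 0 → v ≠ f 0 → h u = !h v := by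
      rintro u v ⟨huv, j, hj⟩ hu hv'
      have hj' : E j ∩ W.erase (f 0) = {u, v} := by
        rw [Finset.inter_erase, hj]
        rw [Finset.erase_eq_of_notMem]
        simp [hu.symm, hv'.symm]
      have := hh j (by rw [hj', Finset.card_pair huv])
      rw [hj'] at this
      have t := this true
      have t' := this false
      simp at t t'
      cases e1 : h u <;> cases e2 : h v <;> simp_all
    have hpar : ∀ i d, 1 ≤ i → i + d ≤ k → h (f (i + d)) = (h (f i) ^^ d.bodd) := by
      intro i d hi
      induction d with
      | zero => simp
      | succ d ihd =>
        intro hd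
        have e := hprop _ _ (hf.2.2 (i + d) (by omega))
          (fun e => by have := hf.2.1 _ (by omega) _ (by omega) e; omega)
          (fun e => by have := hf.2.1 _ (by omega) _ (by omega) e; omega)
        rw [ihd (by omega)] at e
        rw [← add_assoc, Nat.bodd_succ]
        cases h1 : h (f i) <;> cases h2 : h (f (i + d + 1)) <;> cases h3 : d.bodd <;> simp_all
    -- all neighbours have the same color
    have hsame' : ∀ s d, 1 ≤ s → s + d ≤ k → TwoAdj E W (f 0) (f s) →
        TwoAdj E W (f 0) (f (s + d)) → h (f (s + d)) = h (f s) := by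
      intro s d hs hd h1 h2
      rw [hpar s d hs hd]
      cases hd' : d.bodd with
      | false => simp
      | true =>
        exfalso
        have := Nat.bodd_add_div2 d
        rw [hd'] at this
        simp at this
        have e : d = 2 * d.div2 + 1 := by omega
        rw [e] at h2 hd
        exact no_odd_closure E hb W k f hf s d.div2 hs hd h1 h2
    have hsame : ∀ u v, TwoAdj E W (f 0) u → TwoAdj E W (f 0) v → h u = h v := by
      intro u v hu hv'
      obtain ⟨s, hs1, hs2, rfl⟩ := hmax u hu
      obtain ⟨t, ht1, ht2, rfl⟩ := hmax v hv'
      rcases le_total s t with hst | hst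
      · obtain ⟨d, rfl⟩ := Nat.exists_eq_add_of_le hst
        exact (hsame' s d hs1 ht2 hu hv').symm
      · obtain ⟨d, rfl⟩ := Nat.exists_eq_add_of_le hst
        exact hsame' t d ht1 hs2 hv' hu
    obtain ⟨b0, hb0⟩ : ∃ b0 : Bool, ∀ u, TwoAdj E W (f 0) u → h u = b0 := by
      by_cases hex : ∃ u, TwoAdj E W (f 0) u
      · obtain ⟨u, hu⟩ := hex
        exact ⟨h u, fun v hv' => hsame v u hv' hu⟩
      · exact ⟨true, fun u hu => absurd ⟨u, hu⟩ hex⟩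
    refine ⟨Function.update h (f 0) (!b0), ?_⟩
    intro j hj b
    by_cases hbig : 2 ≤ (E j ∩ W.erase (f 0)).card
    · obtain ⟨c, hc, hcb⟩ := hh j hbig b
      simp at hc
      refine ⟨c, by simp [hc], ?_⟩
      rw [Function.update_of_ne hc.2.1, hcb]
    · rw [Finset.inter_erase] at hbig
      have hmem : f 0 ∈ E j ∩ W := by
        by_contra hnot
        rw [Finset.erase_eq_of_notMem hnot] at hbig
        exact hbig hj
      have hcard : ((E j ∩ W).erase (f 0)).card = 1 := by
        have := Finset.card_erase_of_mem hmem
        omega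
      obtain ⟨u, hu⟩ := Finset.card_eq_one.1 hcard
      have hEu : E j ∩ W = {f 0, u} := by
        rw [← Finset.insert_erase hmem, hu]
      have hne : f 0 ≠ u := by
        rintro rfl
        have : f 0 ∈ (E j ∩ W).erase (f 0) := by rw [hu]; simp
        simp at this
      have hcu := hb0 u ⟨hne, j, hEu⟩
      rw [hEu]
      by_cases hbb : b = b0
      · exact ⟨u, by simp, by rw [Function.update_of_ne hne.symm, hcu, hbb]⟩
      · refine ⟨f 0, by simp, ?_⟩
        rw [Function.update_self]
        cases b <;> cases b0 <;> simp_all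

/-- Good `k`-coloring. -/
lemma good_coloring {R C K : Type*} [Fintype R] [Fintype C] [DecidableEq C] [Fintype K]
    [DecidableEq K] [Nonempty K] (E : R → Finset C) (hb : BalFam E) :
    ∃ g : C → K, ∀ j, (∀ a, ∃ c ∈ E j, g c = a) ∨ Set.InjOn g (E j : Set C) := by
  classical
  obtain ⟨g, hg⟩ := Finite.exists_max (fun g : C → K => ∑ j, ((E j).image g).card)
  refine ⟨g, fun j => ?_⟩
  by_contra hcon
  push Not at hcon
  obtain ⟨⟨a, ha⟩, hinj⟩ := hcon
  simp only [Set.InjOn] at hinj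
  push Not at hinj
  obtain ⟨u, hu, v, hv, huv, hne⟩ := hinj
  simp only [Finset.mem_coe] at hu hv
  set b := g u with hbdef
  have hab : a ≠ b := fun h => ha u hu h.symm
  set W : Finset C := Finset.univ.filter (fun c => g c = a ∨ g c = b) with hWdef
  have hW : ∀ c, c ∈ W ↔ g c = a ∨ g c = b := by simp [hWdef]
  obtain ⟨h, hh⟩ := bicolor E hb _ W rfl
  set g' : C → K := fun c => if c ∈ W then (if h c then a else b) else g c with hg'
  have hsplit : ∀ (q : C → K), (∀ c, c ∈ W ↔ q c = a ∨ q c = b) → ∀ i,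
      ((E i).image q).card = ((E i ∩ W).image q).card + ((E i \ W).image q).card := by
    intro q hq i
    rw [← Finset.card_union_of_disjoint, ← Finset.image_union]
    · congr 2
      ext c; simp; tauto
    · rw [Finset.disjoint_left]
      intro y hy hy'
      simp only [Finset.mem_image, Finset.mem_inter, Finset.mem_sdiff] at hy hy'
      obtain ⟨c, ⟨_, hc⟩, rfl⟩ := hy
      obtain ⟨d, ⟨_, hd⟩, hcd⟩ := hy'
      rw [hq] at hc hd
      rw [hcd] at hd
      exact hd hc
  have hW' : ∀ c, c ∈ W ↔ g' c = a ∨ g' c = b := by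
    intro c
    by_cases hc : c ∈ W
    · simp only [hg', hc, if_true, true_iff]
      cases h c <;> simp
    · simp only [hg', hc, if_false, false_iff]
      rwa [← hW]
  have hrest : ∀ i, (E i \ W).image g' = (E i \ W).image g := by
    intro i
    apply Finset.image_congr
    intro c hc
    simp at hc
    simp [hg', hc.2]
  have hbig : ∀ i, 2 ≤ (E i ∩ W).card → 2 ≤ ((E i ∩ W).image g').card := by
    intro i hi
    rw [← Finset.card_pair hab]
    apply Finset.card_le_card
    intro y hy
    simp only [Finset.mem_insert, Finset.mem_singleton] at hy
    rcases hy with rfl | rfl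
    · obtain ⟨c, hc, hcb⟩ := hh i hi true
      exact Finset.mem_image.2 ⟨c, hc, by simp [hg', (Finset.mem_inter.1 hc).2, hcb]⟩
    · obtain ⟨c, hc, hcb⟩ := hh i hi false
      exact Finset.mem_image.2 ⟨c, hc, by simp [hg', (Finset.mem_inter.1 hc).2, hcb]⟩
  have hle2 : ∀ i, ((E i ∩ W).image g).card ≤ 2 := by
    intro i
    rw [← Finset.card_pair hab]
    apply Finset.card_le_card
    intro y hy
    obtain ⟨c, hc, rfl⟩ := Finset.mem_image.1 hy
    have := (hW c).1 (Finset.mem_inter.1 hc).2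
    simpa using this
  have hmono : ∀ i, ((E i ∩ W).image g).card ≤ ((E i ∩ W).image g').card := by
    intro i
    by_cases hi : 2 ≤ (E i ∩ W).card
    · exact (hle2 i).trans (hbig i hi)
    · have e : ((E i ∩ W).image g').card = (E i ∩ W).card := by
        apply Finset.card_image_of_injOn
        intro c hc d hd _
        exact Finset.card_le_one.1 (by omega) c hc d hd
      rw [e]
      exact Finset.card_image_le
  have hlt : ∑ i, ((E i).image g).card < ∑ i, ((E i).image g').card := by
    apply Finset.sum_lt_sum
    · intro i _
      rw [hsplit g hW, hsplit g' hW', hrest]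
      exact Nat.add_le_add_right (hmono i) _
    · refine ⟨j, Finset.mem_univ _, ?_⟩
      rw [hsplit g hW, hsplit g' hW', hrest]
      apply Nat.add_lt_add_right
      have h1 : ((E j ∩ W).image g).card ≤ 1 := by
        rw [← Finset.card_singleton b]
        apply Finset.card_le_card
        intro y hy
        obtain ⟨c, hc, rfl⟩ := Finset.mem_image.1 hy
        have hc' := Finset.mem_inter.1 hc
        rcases (hW c).1 hc'.2 with h | h
        · exact absurd h (ha c hc'.1)
        · simp [h]
      have h2 : 2 ≤ (E j ∩ W).card := by
        rw [← Finset.card_pair hne]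
        apply Finset.card_le_card
        intro y hy
        simp only [Finset.mem_insert, Finset.mem_singleton] at hy
        rcases hy with rfl | rfl
        · simp [hu, hW, hbdef]
        · simp [hv, hW, ← huv]
      have := hbig j h2
      omega
  exact absurd (hg g') (not_le.2 hlt)

lemma balFam_pullback {R C R' C' : Type*} [DecidableEq C] [Fintype C'] (E : R → Finset C)
    (hb : BalFam E) (τ : R' → R) (hτ : Function.Injective τ) (π : C' → C) :
    BalFam (fun j : R' => Finset.univ.filter (fun c => π c ∈ E (τ j))) := by
  intro l ρ c hρ hc H
  simp only [Finset.mem_filter, Finset.mem_univ, true_and] at H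
  refine hb l (τ ∘ ρ) (π ∘ c) (hτ.comp hρ) ?_ H
  intro j k hjk
  simp only [Function.comp] at hjk
  have h1 := (H j k).1 (by rw [← hjk]; exact (H j j).2 (Or.inl rfl))
  have h2 := (H k j).1 (by rw [hjk]; exact (H k k).2 (Or.inl rfl))
  rcases h1 with h1 | h1
  · exact h1.symm
  · rcases h2 with h2 | h2
    · exact h2
    · exact absurd (by rw [← h1, ← h2] : j + 1 + 1 = j) (fin_two_ne l j)

/-- Rational nonnegative solutions contain integral solutions in their support. -/
lemma exists_integral {R C : Type*} [Fintype R] [Fintype C] [DecidableEq C] (E : R → Finset C)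
    (hb : BalFam E) (k : ℕ) (hk : 0 < k) (p : C → ℕ) (hp : ∀ j, ∑ i ∈ E j, p i = k) :
    ∃ y : C → ℕ, (∀ i, p i = 0 → y i = 0) ∧ ∀ j, ∑ i ∈ E j, y i = 1 := by
  classical
  have hb' := balFam_pullback E hb id Function.injective_id (fun c : (Σ i, Fin (p i)) => c.1)
  have : Nonempty (Fin k) := ⟨⟨0, hk⟩⟩
  obtain ⟨g, hg⟩ := good_coloring (K := Fin k) _ hb'
  have hsig : ∀ j, Finset.univ.filter (fun c : (Σ i, Fin (p i)) => c.1 ∈ E j)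
      = (E j).sigma (fun i => Finset.univ) := by
    intro j; ext c; simp
  refine ⟨fun i => (Finset.univ.filter (fun s : Fin (p i) => g ⟨i, s⟩ = ⟨0, hk⟩)).card, ?_, ?_⟩
  · intro i hi
    rw [Finset.card_eq_zero, Finset.filter_eq_empty_iff]
    intro s
    exact absurd s.2 (by omega)
  · intro j
    have hgj := hg j
    simp only [id] at hgj
    rw [hsig] at hgj
    have hcard : ((E j).sigma (fun i => (Finset.univ : Finset (Fin (p i))))).card = k := by
      simp [hp]
    rw [← Finset.card_sigma]
    have e : (E j).sigma (fun i => Finset.univ.filter (fun s : Fin (p i) => g ⟨i, s⟩ = ⟨0, hk⟩))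
        = ((E j).sigma (fun i => (Finset.univ : Finset (Fin (p i))))).filter
          (fun c => g c = ⟨0, hk⟩) := by
      ext c; simp
    rw [e]
    have hinj : Set.InjOn g ((E j).sigma (fun i => (Finset.univ : Finset (Fin (p i))))) := by
      rcases hgj with h | h
      · apply Finset.injOn_of_card_image_eq
        rw [hcard]
        have : ((E j).sigma (fun i => (Finset.univ : Finset (Fin (p i))))).image g
            = Finset.univ := by
          ext a
          simpa only [Finset.mem_image, Finset.mem_univ, iff_true] using h a
        rw [this]; simp
      · exact h
    have himg : ((E j).sigma (fun i => (Finset.univ : Finset (Fin (p i))))).image g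
        = Finset.univ := by
      apply Finset.eq_univ_of_card
      rw [Finset.card_image_of_injOn hinj, hcard]; simp
    obtain ⟨c, hc, hc0⟩ := Finset.mem_image.1
      (by rw [himg]; exact Finset.mem_univ (⟨0, hk⟩ : Fin k))
    rw [Finset.card_eq_one]
    refine ⟨c, ?_⟩
    ext d
    simp only [Finset.mem_filter, Finset.mem_singleton]
    constructor
    · rintro ⟨hd, hd0⟩
      exact hinj hd hc (hd0.trans hc0.symm)
    · rintro rfl
      exact ⟨hc, hc0⟩

open Topology Filter in
lemma extreme_unique {n m : ℕ} (E : Fin m → Finset (Fin n)) (r : ℕ) (x : Fin n → ℝ)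
    (hx : x ∈ Set.extremePoints ℝ (closedSetC1 E r)) (z : Fin n → ℝ)
    (hz0 : ∀ i, x i = 0 → z i = 0)
    (hz : ∀ j, ∑ i ∈ E j, x i = 1 → ∑ i ∈ E j, z i = 1) : z = x := by
  have hxm := hx.1
  obtain ⟨hx0, hxE⟩ := hxm
  set F : ℝ → Fin n → ℝ := fun ε i => x i + ε * (z i - x i) with hF
  have hsum : ∀ ε j, ∑ i ∈ E j, F ε i
      = ∑ i ∈ E j, x i + ε * (∑ i ∈ E j, z i - ∑ i ∈ E j, x i) := by
    intro ε j
    simp only [hF, Finset.sum_add_distrib, ← Finset.mul_sum, Finset.sum_sub_distrib]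
  have hev : ∀ᶠ ε in 𝓝 (0 : ℝ), F ε ∈ closedSetC1 E r := by
    have h1 : ∀ᶠ ε in 𝓝 (0 : ℝ), ∀ i, 0 ≤ F ε i := by
      rw [eventually_all]
      intro i
      rcases (hx0 i).eq_or_lt with h | h
      · refine Eventually.of_forall fun ε => ?_
        simp [hF, ← h, hz0 i h.symm]
      · have hc : Tendsto (fun ε : ℝ => F ε i) (𝓝 0) (𝓝 (F 0 i)) := by
          apply Continuous.tendsto
          simp only [hF]; fun_prop
        exact (hc.eventually (lt_mem_nhds (by simpa [hF] using h))).mono fun _ h => h.le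
    have h2 : ∀ᶠ ε in 𝓝 (0 : ℝ), ∀ j : Fin m, ((j : ℕ) < r → ∑ i ∈ E j, F ε i ≤ 1) ∧
        (r ≤ (j : ℕ) → 1 ≤ ∑ i ∈ E j, F ε i) := by
      rw [eventually_all]
      intro j
      simp only [hsum]
      have hc : Tendsto (fun ε : ℝ => ∑ i ∈ E j, x i +
          ε * (∑ i ∈ E j, z i - ∑ i ∈ E j, x i)) (𝓝 0) (𝓝 (∑ i ∈ E j, x i)) := by
        have : Continuous (fun ε : ℝ => ∑ i ∈ E j, x i +
          ε * (∑ i ∈ E j, z i - ∑ i ∈ E j, x i)) := by fun_prop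
        simpa using this.tendsto 0
      rcases lt_trichotomy (∑ i ∈ E j, x i) 1 with h | h | h
      · refine (hc.eventually (gt_mem_nhds h)).mono fun ε hε => ⟨fun _ => hε.le, fun hr => ?_⟩
        exact absurd ((hxE j).2 hr) (not_le.2 h)
      · refine Eventually.of_forall fun ε => ?_
        rw [h, hz j h]; simp
      · refine (hc.eventually (lt_mem_nhds h)).mono fun ε hε => ⟨fun hr => ?_, fun _ => hε.le⟩
        exact absurd ((hxE j).1 hr) (not_le.2 h)
    filter_upwards [h1, h2] with ε a b using ⟨a, b⟩
  rw [Metric.eventually_nhds_iff] at hev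
  obtain ⟨δ, hδ, hev⟩ := hev
  have ha := hev (y := δ / 2) (by rw [Real.dist_eq, sub_zero, abs_of_pos] <;> linarith)
  have hb := hev (y := -(δ / 2)) (by
    rw [Real.dist_eq, sub_zero, abs_neg, abs_of_pos] <;> linarith)
  have hseg : x ∈ openSegment ℝ (F (δ / 2)) (F (-(δ / 2))) := by
    refine ⟨1 / 2, 1 / 2, by norm_num, by norm_num, by norm_num, ?_⟩
    ext i
    simp [hF]; ring
  have he := hx.2 ha hb hseg
  ext i
  have hi := congrFun he i
  simp only [hF] at hi
  have : δ / 2 * (z i - x i) = 0 := by linarith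
  rcases mul_eq_zero.1 this with h | h
  · linarith
  · linarith

lemma exists_rat_retraction : ∃ φ : ℝ →ₗ[ℚ] ℚ, φ 1 = 1 := by
  have hinj : LinearMap.ker (LinearMap.toSpanSingleton ℚ ℝ 1) = ⊥ := by
    rw [LinearMap.ker_eq_bot]
    intro a b h
    simpa [LinearMap.toSpanSingleton_apply, Rat.smul_def] using h
  obtain ⟨φ, hφ⟩ := LinearMap.exists_leftInverse_of_injective _ hinj
  refine ⟨φ, ?_⟩
  have := LinearMap.congr_fun hφ 1
  simpa [LinearMap.toSpanSingleton_apply] using this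

/-- If the incidence matrix of `E_1,…,E_m` is balanced and the polytope `C̄₁` is nonempty
and bounded, then every vertex (extreme point) of `C̄₁` has all coordinates in `{0,1}`;
in particular every vertex is an integer point. -/
theorem extremePoints_zero_one_of_balanced {n m : ℕ} (E : Fin m → Finset (Fin n))
    (r : ℕ) (hr : 1 ≤ r) (hrm : r ≤ m)
    (hbal : IsBalancedMatrix (incidenceMatrix E))
    (hne : (closedSetC1 E r).Nonempty)
    (hbd : Bornology.IsBounded (closedSetC1 E r)) :
    ∀ x ∈ Set.extremePoints ℝ (closedSetC1 E r),
      (∀ i, x i = 0 ∨ x i = 1) ∧ ∀ i, ∃ a : ℤ, x i = a := by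
  classical
  intro x hx
  have hx0 : ∀ i, 0 ≤ x i := hx.1.1
  have huniq := extreme_unique E r x hx
  have hB : BalFam E := by
    intro l ρ c hρ hc H
    refine hbal l ρ c hρ hc fun i j => ?_
    simp only [incidenceMatrix, H]
  have hB' : BalFam (fun j : {j // ∑ i ∈ E j, x i = 1} => E j.1) := by
    have := balFam_pullback E hB (fun j : {j // ∑ i ∈ E j, x i = 1} => j.1)
      Subtype.val_injective (id : Fin n → Fin n)
    simpa using this
  -- rationality
  obtain ⟨φ, hφ⟩ := exists_rat_retraction
  have hrat : (fun i => ((φ (x i) : ℚ) : ℝ)) = x := by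
    apply huniq
    · intro i hi; simp [hi]
    · intro j hj
      rw [← Rat.cast_sum, ← map_sum, hj, hφ]; simp
  set q : Fin n → ℚ := fun i => φ (x i) with hq
  have hqx : ∀ i, x i = (q i : ℝ) := fun i => (congrFun hrat i).symm
  have hq0 : ∀ i, 0 ≤ q i := fun i => by
    have := hx0 i
    rw [hqx] at this
    exact_mod_cast this
  have hdk : ∀ i, (q i).den ∣ ∏ i, (q i).den := fun i =>
    Finset.dvd_prod_of_mem _ (Finset.mem_univ i)
  set k := ∏ i, (q i).den with hkdef
  have hk : 0 < k := Finset.prod_pos fun i _ => (q i).den_pos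
  choose e he using hdk
  have hp : ∀ i, (((q i).num.toNat * e i : ℕ) : ℝ) = k * x i := by
    intro i
    have h1 : (((q i).num.toNat : ℤ)) = (q i).num := Int.toNat_of_nonneg (Rat.num_nonneg.2 (hq0 i))
    have h2 : (((q i).num.toNat : ℕ) : ℚ) = q i * (q i).den := by
      rw [Rat.mul_den_eq_num]; exact_mod_cast h1
    have h3 : (((q i).num.toNat * e i : ℕ) : ℚ) = k * q i := by
      rw [he i]; push_cast; rw [h2]; ring
    rw [hqx]; exact_mod_cast h3
  obtain ⟨y, hy0, hy1⟩ := exists_integral _ hB' k hk (fun i => (q i).num.toNat * e i) (by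
    rintro ⟨j, hj⟩
    have : ((∑ i ∈ E j, ((q i).num.toNat * e i) : ℕ) : ℝ) = k := by
      rw [Nat.cast_sum, Finset.sum_congr rfl (fun i _ => hp i), ← Finset.mul_sum, hj, mul_one]
    exact_mod_cast this)
  have hyx : (fun i => (y i : ℝ)) = x := by
    apply huniq
    · intro i hi
      have : y i = 0 := hy0 i (by
        have := hp i
        rw [hi, mul_zero] at this
        exact_mod_cast this)
      simp [this]
    · intro j hj
      have := hy1 ⟨j, hj⟩
      exact_mod_cast this
  have hyx' : ∀ i, x i = (y i : ℝ) := fun i => (congrFun hyx i).symm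
  have h01 : ∀ i, x i = 0 ∨ x i = 1 := by
    intro i
    by_cases h0 : x i = 0
    · exact Or.inl h0
    right
    have hex : ∃ j, ∑ i ∈ E j, x i = 1 ∧ i ∈ E j := by
      by_contra hcon
      push Not at hcon
      have := huniq (Function.update x i (x i + 1)) (by
        intro i' hi'
        have hne' : i' ≠ i := by rintro rfl; exact h0 hi'
        rw [Function.update_of_ne hne', hi']) (by
        intro j hj
        rw [Finset.sum_update_of_notMem (hcon j hj), hj])
      have := congrFun this i
      simp at this
    obtain ⟨j, hj, hij⟩ := hex
    have hle : x i ≤ 1 := by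
      rw [← hj]
      exact Finset.single_le_sum (fun i _ => hx0 i) hij
    rw [hyx'] at hle h0 ⊢
    have a1 : y i ≤ 1 := by exact_mod_cast hle
    have a2 : y i ≠ 0 := by exact_mod_cast h0
    have : y i = 1 := by omega
    simp [this]
  exact ⟨h01, fun i => ⟨y i, by rw [hyx']; simp⟩⟩
end

section
/- Let E_1,...,E_m ⊆ {1,...,n} define, for each t ≥ 1, the set Ω_t ⊆ ℝ^n of solutions of: ∑_{i∈E_j} x_i ≤ t−1 for j = 1,...,r; ∑_{i∈E_j} x_i ≥ t for j = r+1,...,m; x_i ≥ 0. Suppose the incidence matrix of E_1,...,E_m is balanced. If Ω_t ∩ ℕ^n ≠ ∅, then Ω_{t+1} ∩ ℕ^n ≠ ∅. -/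
/-- `Ω_t`: the solutions of `∑_{i∈E_j} x_i ≤ t−1` for `j ≤ r`, `∑_{i∈E_j} x_i ≥ t` for
`j > r`, `x ≥ 0`. -/
def OmegaSet {n m : ℕ} (E : Fin m → Finset (Fin n)) (r : ℕ) (t : ℕ) : Set (Fin n → ℝ) :=
  {x | (∀ i, 0 ≤ x i) ∧
    ∀ j : Fin m, ((j : ℕ) < r → ∑ i ∈ E j, x i ≤ (t : ℝ) - 1) ∧
      (r ≤ (j : ℕ) → (t : ℝ) ≤ ∑ i ∈ E j, x i)}

/-- Cyclic pattern of odd order in a set family. -/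
def HasPat {V J : Type*} (e : J → Finset V) : Prop :=
  ∃ (l : ℕ) (ρ : Fin (2 * l + 3) → J) (c : Fin (2 * l + 3) → V),
    ∀ i j, c j ∈ e (ρ i) ↔ (j = i ∨ j = i + 1)

theorem fin_aux (l : ℕ) (i j : Fin (2 * l + 3)) (h1 : i = j + 1) (h2 : j = i + 1) : False := by
  have h3 : i + 0 = i + (1 + 1) := by
    rw [← add_assoc, ← h2, ← h1, add_zero]
  have h4 := add_left_cancel h3
  have := congrArg Fin.val h4
  simp [Fin.val_add] at this
  rw [Nat.mod_eq_of_lt (by omega)] at this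
  omega

theorem not_hasPat_of_balanced {n m : ℕ} (E : Fin m → Finset (Fin n))
    (h : IsBalancedMatrix (incidenceMatrix E)) : ¬ HasPat E := by
  rintro ⟨l, ρ, c, hp⟩
  refine h l ρ c ?_ ?_ ?_
  · intro i i' hi
    have h1 := (hp i i).2 (Or.inl rfl)
    have h2 := (hp i' i').2 (Or.inl rfl)
    rw [hi, hp] at h1
    rw [← hi, hp] at h2
    rcases h1 with h1 | h1
    · exact h1
    rcases h2 with h2 | h2
    · exact h2.symm
    exact (fin_aux l _ _ h1 h2).elim
  · intro j j' hj
    have h1 := (hp j j).2 (Or.inl rfl)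
    have h2 := (hp j' j').2 (Or.inl rfl)
    rw [hj, hp] at h1
    rw [← hj, hp] at h2
    rcases h1 with h1 | h1
    · exact h1.symm
    rcases h2 with h2 | h2
    · exact h2
    exact (fin_aux l _ _ h1 h2).elim
  · intro i j
    simp only [incidenceMatrix, hp]

/-- A path of 2-element traces. -/
def IsPth {V J : Type*} [DecidableEq V] (e : J → Finset V) (S : Finset V) (p : ℕ → V) (l : ℕ) :
    Prop :=
  (∀ i ≤ l, p i ∈ S) ∧ (∀ i ≤ l, ∀ j ≤ l, p i = p j → i = j) ∧
    ∀ i < l, ∃ j, e j ∩ S = {p i, p (i + 1)}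

theorem isPth_lt {V J : Type*} [DecidableEq V] (e : J → Finset V) (S : Finset V) (p : ℕ → V)
    (l : ℕ) (h : IsPth e S p l) : l < S.card := by
  have : (Finset.range (l + 1)).card ≤ S.card := by
    apply Finset.card_le_card_of_injOn p
    · intro i hi
      exact h.1 i (by simp at hi; omega)
    · intro i hi j hj hij
      simp at hi hj
      exact h.2.1 i (by omega) j (by omega) hij
  simpa using this

theorem exists_max_pth {V J : Type*} [DecidableEq V] (e : J → Finset V) (S : Finset V)
    (hS : S.Nonempty) : ∃ p l, IsPth e S p l ∧ ∀ q, ¬ IsPth e S q (l + 1) := by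
  by_contra! H
  obtain ⟨x, hx⟩ := hS
  have : ∀ l, ∃ p, IsPth e S p l := by
    intro l
    induction l with
    | zero => exact ⟨fun _ => x, fun _ _ => hx, by intros; omega, by intros; omega⟩
    | succ l ih => obtain ⟨p, hp⟩ := ih; exact H p l hp
  obtain ⟨p, hp⟩ := this S.card
  exact absurd (isPth_lt e S p _ hp) (lt_irrefl _)

theorem pth_odd {V J : Type*} [DecidableEq V] (e : J → Finset V) (he : ¬ HasPat e)
    (S : Finset V) (p : ℕ → V) (l : ℕ) (h : IsPth e S p l) (k : ℕ) (hk : k ≤ l) (hk1 : 1 ≤ k)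
    (j : J) (hj : e j ∩ S = {p 0, p k}) : Odd k := by
  by_contra hodd
  rw [Nat.not_odd_iff_even] at hodd
  obtain ⟨a, ha⟩ := hodd
  obtain ⟨d, rfl⟩ : ∃ d, a = d + 1 := ⟨a - 1, by omega⟩
  have hk' : k = 2 * d + 2 := by omega
  subst hk'
  obtain ⟨h1, h2, h3⟩ := h
  have : Nonempty J := ⟨j⟩
  choose! ρ hρ using h3
  apply he
  refine ⟨d, fun i => if (i : ℕ) < 2 * d + 2 then ρ i else j, fun i => p i, ?_⟩
  intro i i'
  have hi := i.2
  have hi' := i'.2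
  have hS := h1 i' (by omega)
  have hinj : ∀ a ≤ l, (p i' = p a ↔ (i' : ℕ) = a) := fun a ha =>
    ⟨h2 _ (by omega) _ ha, fun h => by rw [h]⟩
  have key : ∀ j', p i' ∈ e j' ↔ p i' ∈ e j' ∩ S := by intro j'; simp [hS]
  rw [key]
  by_cases hlt : (i : ℕ) < 2 * d + 2
  · simp only [hlt, if_true]
    rw [hρ i (by omega)]
    simp only [Finset.mem_insert, Finset.mem_singleton]
    rw [hinj _ (by omega), hinj _ (by omega), Fin.ext_iff, Fin.ext_iff,
      Fin.val_add_one_of_lt (by rw [Fin.lt_def]; simpa using hlt)]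
  · simp only [hlt, if_false]
    rw [hj]
    simp only [Finset.mem_insert, Finset.mem_singleton]
    rw [hinj _ (by omega), hinj _ (by omega)]
    have : i = Fin.last (2 * d + 2) := by apply Fin.ext; simp; omega
    subst this
    rw [Fin.last_add_one, Fin.ext_iff, Fin.ext_iff]
    simp
    tauto

theorem exists_bicoloring {V J : Type*} [DecidableEq V] (e : J → Finset V) (he : ¬ HasPat e)
    (N : ℕ) : ∀ S : Finset V, S.card = N → ∃ c : V → Bool, ∀ j, 2 ≤ (e j ∩ S).card →
      ∃ x ∈ e j ∩ S, ∃ y ∈ e j ∩ S, c x ≠ c y := by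
  induction N with
  | zero =>
    intro S hS
    rw [Finset.card_eq_zero] at hS
    subst hS
    exact ⟨fun _ => true, by simp⟩
  | succ N ih =>
    intro S hS
    obtain ⟨p, l, hp, hmax⟩ := exists_max_pth e S (by rw [← Finset.card_pos]; omega)
    have hp0 : p 0 ∈ S := hp.1 0 (by omega)
    obtain ⟨c, hc⟩ := ih (S.erase (p 0)) (by rw [Finset.card_erase_of_mem hp0]; omega)
    have hne : ∀ i ≤ l, 1 ≤ i → p i ≠ p 0 := fun i hi h1 h => by
      have := hp.2.1 i hi 0 (by omega) h
      omega
    have halt : ∀ i, 1 ≤ i → i < l → c (p i) ≠ c (p (i + 1)) := by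
      intro i h1 hil
      obtain ⟨j, hj⟩ := hp.2.2 i hil
      have n1 := hne i (by omega) h1
      have n2 := hne (i + 1) (by omega) (by omega)
      have n3 : p i ≠ p (i + 1) := fun h => by
        have := hp.2.1 i (by omega) (i + 1) (by omega) h
        omega
      have hj' : e j ∩ S.erase (p 0) = {p i, p (i + 1)} := by
        rw [← Finset.erase_eq_of_notMem (s := {p i, p (i + 1)}) (a := p 0), ← hj,
          Finset.inter_erase]
        simp [n1.symm, n2.symm]
      have := hc j (by rw [hj', Finset.card_pair n3])
      rw [hj'] at this
      obtain ⟨x, hx, y, hy, hxy⟩ := this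
      simp only [Finset.mem_insert, Finset.mem_singleton] at hx hy
      rcases hx with rfl | rfl <;> rcases hy with rfl | rfl
      · exact absurd rfl hxy
      · exact hxy
      · exact hxy.symm
      · exact absurd rfl hxy
    have hodd : ∀ d, 2 * d + 1 ≤ l → c (p (2 * d + 1)) = c (p 1) := by
      intro d
      induction d with
      | zero => intro _; rfl
      | succ d ihd =>
        intro hd
        rw [← ihd (by omega)]
        have a1 := halt (2 * d + 1) (by omega) (by omega)
        have a2 := halt (2 * d + 2) (by omega) (by omega)
        have : 2 * (d + 1) + 1 = 2 * d + 2 + 1 := by ring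
        rw [this]
        generalize c (p (2 * d + 2 + 1)) = u at *
        change c (p (2 * d + 1)) ≠ c (p (2 * d + 2)) at a1
        generalize c (p (2 * d + 2)) = v at *
        generalize c (p (2 * d + 1)) = w at *
        revert a1 a2
        cases u <;> cases v <;> cases w <;> simp
    have hnb : ∀ j y, y ≠ p 0 → e j ∩ S = {p 0, y} → c y = c (p 1) := by
      intro j y hy hj
      have hyS : y ∈ S := by
        have : y ∈ e j ∩ S := by rw [hj]; simp
        exact (Finset.mem_inter.1 this).2
      by_cases hpath : ∃ k ≤ l, p k = y
      · obtain ⟨k, hk, rfl⟩ := hpath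
        have hk1 : 1 ≤ k := by
          rcases Nat.eq_zero_or_pos k with h | h
          · subst h; exact absurd rfl hy
          · exact h
        obtain ⟨d, rfl⟩ := pth_odd e he S p l hp k hk hk1 j hj
        exact hodd d hk
      · push Not at hpath
        exfalso
        refine hmax (fun i => if i = 0 then y else p (i - 1)) ⟨?_, ?_, ?_⟩
        · intro i hi
          by_cases h : i = 0
          · simp [h, hyS]
          · simp only [h, if_false]; exact hp.1 _ (by omega)
        · intro i hi i' hi' hii
          by_cases h : i = 0 <;> by_cases h' : i' = 0
          · omega
          · simp only [h, h', if_true, if_false] at hii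
            exact absurd hii.symm (hpath _ (by omega))
          · simp only [h, h', if_true, if_false] at hii
            exact absurd hii (hpath _ (by omega))
          · simp only [h, h', if_false] at hii
            have := hp.2.1 _ (by omega) _ (by omega) hii
            omega
        · intro i hi
          by_cases h : i = 0
          · subst h
            refine ⟨j, ?_⟩
            simp [hj, Finset.pair_comm]
          · obtain ⟨j', hj'⟩ := hp.2.2 (i - 1) (by omega)
            refine ⟨j', ?_⟩
            rw [hj', Nat.sub_add_cancel (by omega)]
            simp [h]
    refine ⟨fun v => if v = p 0 then !(c (p 1)) else c v, ?_⟩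
    intro j hj
    by_cases h2 : 2 ≤ (e j ∩ S.erase (p 0)).card
    · obtain ⟨x, hx, y, hy, hxy⟩ := hc j h2
      simp only [Finset.mem_inter, Finset.mem_erase] at hx hy
      refine ⟨x, by simp [hx], y, by simp [hy], ?_⟩
      simp [hx, hy, hxy]
    · have hmem : p 0 ∈ e j ∩ S := by
        by_contra hn
        rw [Finset.inter_erase, Finset.erase_eq_of_notMem hn] at h2
        exact h2 hj
      have hcard : (e j ∩ S).card = 2 := by
        rw [Finset.inter_erase, Finset.card_erase_of_mem hmem] at h2
        omega
      obtain ⟨y, hy, hyne⟩ := Finset.exists_mem_ne (by omega) (p 0) (s := e j ∩ S)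
      have hpair : e j ∩ S = {p 0, y} := by
        symm
        apply Finset.eq_of_subset_of_card_le
        · intro z hz
          simp only [Finset.mem_insert, Finset.mem_singleton] at hz
          rcases hz with rfl | rfl
          · exact hmem
          · exact hy
        · rw [hcard, Finset.card_pair hyne.symm]
      refine ⟨p 0, hmem, y, hy, ?_⟩
      have := hnb j y hyne hpair
      simp [hyne, this]

theorem exists_good_coloring_s9 {V J : Type*} [DecidableEq V] [Fintype V] [Fintype J]
    (e : J → Finset V) (he : ¬ HasPat e) (t : ℕ) (ht : 1 ≤ t) :
    ∃ f : V → Fin t, ∀ j, (∀ a, a ∈ (e j).image f) ∨ Set.InjOn f (e j) := by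
  have : Nonempty (V → Fin t) := ⟨fun _ => ⟨0, ht⟩⟩
  obtain ⟨f, hf⟩ := Finite.exists_max (fun f : V → Fin t => ∑ j, ((e j).image f).card)
  refine ⟨f, fun j => ?_⟩
  by_contra! H
  obtain ⟨⟨a, ha⟩, hinj⟩ := H
  unfold Set.InjOn at hinj
  push Not at hinj
  obtain ⟨x, hx, y, hy, hxy, hne⟩ := hinj
  set b := f x with hb
  have hab : a ≠ b := by
    rintro h
    exact ha (by rw [h, hb]; exact Finset.mem_image_of_mem _ hx)
  set S : Finset V := Finset.univ.filter (fun v => f v = a ∨ f v = b) with hS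
  have memS : ∀ v, v ∈ S ↔ (f v = a ∨ f v = b) := by intro v; simp [hS]
  obtain ⟨c, hc⟩ := exists_bicoloring e he _ S rfl
  let g : V → Fin t := fun v => if v ∈ S then (if c v then a else b) else f v
  have gS : ∀ v ∈ S, g v = a ∨ g v = b := by
    intro v hv
    simp only [g, hv, if_true]
    split_ifs <;> simp
  have gN : ∀ v, v ∉ S → g v = f v := by intro v hv; simp [g, hv]
  have hbig : ∀ j, 2 ≤ (e j ∩ S).card → a ∈ (e j).image g ∧ (e j).image f ⊆ (e j).image g := by
    intro j hj
    obtain ⟨u, hu, w, hw, huw⟩ := hc j hj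
    rw [Finset.mem_inter] at hu hw
    have hga : a ∈ (e j).image g ∧ b ∈ (e j).image g := by
      simp only [Finset.mem_image]
      cases hcu : c u <;> cases hcw : c w
      · simp [hcu, hcw] at huw
      · exact ⟨⟨w, hw.1, by simp [g, hw.2, hcw]⟩, ⟨u, hu.1, by simp [g, hu.2, hcu]⟩⟩
      · exact ⟨⟨u, hu.1, by simp [g, hu.2, hcu]⟩, ⟨w, hw.1, by simp [g, hw.2, hcw]⟩⟩
      · simp [hcu, hcw] at huw
    refine ⟨hga.1, ?_⟩
    intro z hz
    obtain ⟨v, hv, rfl⟩ := Finset.mem_image.1 hz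
    by_cases hvS : v ∈ S
    · rcases (memS v).1 hvS with h | h <;> rw [h]
      · exact hga.1
      · exact hga.2
    · rw [← gN v hvS]
      exact Finset.mem_image_of_mem _ hv
  have hle : ∀ j, ((e j).image f).card ≤ ((e j).image g).card := by
    intro j
    by_cases hj : 2 ≤ (e j ∩ S).card
    · exact Finset.card_le_card (hbig j hj).2
    · have him : ((e j).filter (· ∉ S)).image g = ((e j).filter (· ∉ S)).image f := by
        apply Finset.image_congr
        intro v hv
        simp at hv
        exact gN v hv.2
      by_cases hv : ∃ v, v ∈ e j ∩ S
      · obtain ⟨v, hv⟩ := hv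
        have hv' := Finset.mem_inter.1 hv
        have hej : e j = insert v ((e j).filter (· ∉ S)) := by
          ext z
          simp only [Finset.mem_insert, Finset.mem_filter]
          constructor
          · intro hz
            by_cases hzS : z ∈ S
            · left
              exact Finset.card_le_one.1 (by omega) z (Finset.mem_inter.2 ⟨hz, hzS⟩) v hv
            · exact Or.inr ⟨hz, hzS⟩
          · rintro (rfl | h)
            · exact hv'.1
            · exact h.1
        have hnot : ∀ z, (z = a ∨ z = b) → z ∉ ((e j).filter (· ∉ S)).image f := by
          intro z hz hm
          obtain ⟨w, hw, rfl⟩ := Finset.mem_image.1 hm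
          exact (Finset.mem_filter.1 hw).2 ((memS w).2 hz)
        rw [hej, Finset.image_insert, Finset.image_insert, him,
          Finset.card_insert_of_notMem (hnot _ ((memS v).1 hv'.2)),
          Finset.card_insert_of_notMem (hnot _ (gS v hv'.2))]
      · have : (e j).filter (· ∉ S) = e j := by
          apply Finset.filter_true_of_mem
          intro v hvj hvS
          exact hv ⟨v, Finset.mem_inter.2 ⟨hvj, hvS⟩⟩
        rw [this] at him
        rw [him]
  have hlt : ((e j).image f).card < ((e j).image g).card := by
    have h2 : 2 ≤ (e j ∩ S).card := by
      have : ({x, y} : Finset V) ⊆ e j ∩ S := by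
        intro z hz
        simp only [Finset.mem_insert, Finset.mem_singleton] at hz
        rcases hz with rfl | rfl
        · exact Finset.mem_inter.2 ⟨hx, (memS _).2 (Or.inr rfl)⟩
        · exact Finset.mem_inter.2 ⟨hy, (memS _).2 (Or.inr hxy.symm)⟩
      have h3 := Finset.card_le_card this
      rwa [Finset.card_pair hne] at h3
    apply Finset.card_lt_card
    exact Finset.ssubset_iff_subset_ne.2 ⟨(hbig j h2).2, fun h => ha (by rw [h]; exact (hbig j h2).1)⟩
  have := Finset.sum_lt_sum (fun j _ => hle j) ⟨j, Finset.mem_univ j, hlt⟩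
  exact absurd (hf g) (not_le.2 this)

/-- If the incidence matrix is balanced and `Ω_t` contains a point of `ℕⁿ`, then so
does `Ω_{t+1}`. -/
theorem omega_succ_nat_point {n m : ℕ} (E : Fin m → Finset (Fin n)) (r : ℕ)
    (hr : 1 ≤ r) (hrm : r ≤ m)
    (hbal : IsBalancedMatrix (incidenceMatrix E)) (t : ℕ) (ht : 1 ≤ t)
    (hΩ : ∃ x ∈ OmegaSet E r t, ∀ i, ∃ a : ℕ, x i = a) :
    ∃ x ∈ OmegaSet E r (t + 1), ∀ i, ∃ a : ℕ, x i = a := by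
  obtain ⟨x, ⟨hx0, hx⟩, hxa⟩ := hΩ
  choose α hα using hxa
  let e : Fin m → Finset (Σ i : Fin n, Fin (α i)) := fun j => (E j).sigma (fun _ => Finset.univ)
  have he : ¬ HasPat e := by
    rintro ⟨l, ρ, c, hp⟩
    refine not_hasPat_of_balanced E hbal ⟨l, ρ, fun j => (c j).1, ?_⟩
    intro i j
    rw [← hp]
    simp [e]
  obtain ⟨f, hf⟩ := exists_good_coloring_s9 e he t ht
  let a0 : Fin t := ⟨0, ht⟩
  let γ : Fin n → ℕ := fun i => (Finset.univ.filter (fun s : Fin (α i) => f ⟨i, s⟩ = a0)).card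
  have hcard : ∀ j, (e j).card = ∑ i ∈ E j, α i := by
    intro j
    simp [e, Finset.card_sigma]
  have hγ : ∀ j, ∑ i ∈ E j, γ i = ((e j).filter (fun v => f v = a0)).card := by
    intro j
    have : (e j).filter (fun v => f v = a0) =
        (E j).sigma (fun i => Finset.univ.filter (fun s : Fin (α i) => f ⟨i, s⟩ = a0)) := by
      ext ⟨i, s⟩
      simp [e]
    rw [this, Finset.card_sigma]
  have hsum : ∀ j, ∑ i ∈ E j, x i = ((e j).card : ℝ) := by
    intro j
    rw [hcard]
    push_cast
    exact Finset.sum_congr rfl (fun i _ => hα i)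
  refine ⟨fun i => ((α i + γ i : ℕ) : ℝ), ⟨fun i => Nat.cast_nonneg _, fun j => ?_⟩,
    fun i => ⟨_, rfl⟩⟩
  have hs2 : ∑ i ∈ E j, ((α i + γ i : ℕ) : ℝ) =
      (((e j).card + ((e j).filter (fun v => f v = a0)).card : ℕ) : ℝ) := by
    rw [← hγ, hcard, ← Finset.sum_add_distrib]
    push_cast
    rfl
  obtain ⟨hp, hc⟩ := hx j
  rw [hsum] at hp hc
  rw [hs2]
  constructor
  · intro hj
    have h1 : (e j).card + 1 ≤ t := by
      have := hp hj
      have h2 : ((e j).card : ℝ) + 1 ≤ t := by linarith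
      exact_mod_cast h2
    have hinj : Set.InjOn f (e j) := by
      rcases hf j with h | h
      · exfalso
        have h2 : (e j).image f = Finset.univ := Finset.eq_univ_iff_forall.2 h
        have h3 : ((e j).image f).card ≤ (e j).card := Finset.card_image_le
        rw [h2, Finset.card_univ, Fintype.card_fin] at h3
        omega
      · exact h
    have h4 : ((e j).filter (fun v => f v = a0)).card ≤ 1 := by
      rw [Finset.card_le_one]
      intro u hu w hw
      rw [Finset.mem_filter] at hu hw
      exact hinj hu.1 hw.1 (hu.2.trans hw.2.symm)
    have h5 : (e j).card + ((e j).filter (fun v => f v = a0)).card ≤ t := by omega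
    have h6 : (((e j).card + ((e j).filter (fun v => f v = a0)).card : ℕ) : ℝ) ≤ t := by
      exact_mod_cast h5
    push_cast at h6 ⊢
    linarith
  · intro hj
    have h1 : t ≤ (e j).card := by exact_mod_cast hc hj
    have hsurj : ∀ a, a ∈ (e j).image f := by
      rcases hf j with h | h
      · exact h
      · have h2 := Finset.card_image_of_injOn h
        have h3 : (e j).image f = Finset.univ := by
          apply Finset.eq_univ_of_card
          apply le_antisymm (Finset.card_le_univ _)
          rw [h2, Fintype.card_fin]
          exact h1
        intro a
        rw [h3]
        exact Finset.mem_univ a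
    have h4 : 0 < ((e j).filter (fun v => f v = a0)).card := by
      obtain ⟨v, hv, hva⟩ := Finset.mem_image.1 (hsurj a0)
      exact Finset.card_pos.2 ⟨v, Finset.mem_filter.2 ⟨hv, hva⟩⟩
    have h5 : t + 1 ≤ (e j).card + ((e j).filter (fun v => f v = a0)).card := by omega
    exact_mod_cast h5
end

section
/- Let G be a bipartite graph with cover ideal J(G) ⊆ R = K[x_1,...,x_n]. Then the function t ↦ depth R/J(G)^t is non-increasing. -/
open MvPolynomial

/-- The cover ideal of a graph `G`: the intersection of the ideals `(x_i, x_j)` over the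
edges `{i,j}` of `G`. -/
noncomputable def graphCoverIdeal {n : ℕ} (K : Type*) [Field K] (G : SimpleGraph (Fin n))
    [DecidableRel G.Adj] : Ideal (MvPolynomial (Fin n) K) :=
  ⨅ e ∈ G.edgeFinset, Ideal.span {p : MvPolynomial (Fin n) K | ∃ i ∈ e, p = X i}

/-- The depth of `R/I` with respect to `m = (x_1,…,x_n)`. -/
noncomputable def quotDepth {n : ℕ} (K : Type*) [Field K]
    (I : Ideal (MvPolynomial (Fin n) K)) : ℕ :=
  sSup {k : ℕ | ∃ rs : List (MvPolynomial (Fin n) K), rs.length = k ∧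
    (∀ r ∈ rs, r ∈ Ideal.span (Set.range (X : Fin n → MvPolynomial (Fin n) K))) ∧
    RingTheory.Sequence.IsRegular (MvPolynomial (Fin n) K ⧸ I) rs}

/-- `r` is a nonzerodivisor modulo `I`. -/
def RegMod {A : Type*} [CommRing A] (I : Ideal A) (r : A) : Prop := ∀ g, r * g ∈ I → g ∈ I

/-- Weakly regular sequences modulo an ideal, phrased with ideals only. -/
def WReg {A : Type*} [CommRing A] : Ideal A → List A → Prop
  | _, [] => True
  | I, r :: rs => RegMod I r ∧ WReg (I ⊔ Ideal.span {r}) rs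

/-- There is a weakly regular sequence of length `k` in `m` modulo `I`. -/
def HasD {A : Type*} [CommRing A] (m : Ideal A) : ℕ → Ideal A → Prop
  | 0, _ => True
  | k + 1, I => ∃ r ∈ m, RegMod I r ∧ HasD m k (I ⊔ Ideal.span {r})

section general
variable {A : Type*} [CommRing A]

lemma regMod_iff (I : Ideal A) (r : A) : IsSMulRegular (A ⧸ I) r ↔ RegMod I r := by
  rw [isSMulRegular_iff_right_eq_zero_of_smul]
  constructor
  · intro h g hg
    have := h (Ideal.Quotient.mk I g) (by
      rw [← Ideal.Quotient.mk_eq_mk, ← Submodule.Quotient.mk_smul, Submodule.Quotient.mk_eq_zero]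
      exact hg)
    exact Ideal.Quotient.eq_zero_iff_mem.1 this
  · intro h x
    obtain ⟨g, rfl⟩ := Ideal.Quotient.mk_surjective x
    intro hx
    rw [← Ideal.Quotient.mk_eq_mk, ← Submodule.Quotient.mk_smul, Submodule.Quotient.mk_eq_zero] at hx
    exact Ideal.Quotient.eq_zero_iff_mem.2 (h g hx)

open Pointwise in
lemma wreg_iff (rs : List A) : ∀ I : Ideal A,
    RingTheory.Sequence.IsWeaklyRegular (A ⧸ I) rs ↔ WReg I rs := by
  induction rs with
  | nil => intro I; simp [WReg]
  | cons r rs ih =>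
    intro I
    rw [RingTheory.Sequence.isWeaklyRegular_cons_iff, WReg, regMod_iff, ← ih]
    have h : (r • (⊤ : Submodule A (A ⧸ I))) = Submodule.map I.mkQ (Ideal.span {r}) := by
      rw [← Submodule.ideal_span_singleton_smul, ← Submodule.range_mkQ I, LinearMap.range_eq_map,
        ← Submodule.map_smul'']
      congr 1
      simp
    have e : QuotSMulTop r (A ⧸ I) ≃ₗ[A] A ⧸ (I ⊔ Ideal.span {r}) :=
      (Submodule.quotEquivOfEq _ _ h) ≪≫ₗ Submodule.quotientQuotientEquivQuotientSup I _
    rw [e.isWeaklyRegular_congr]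

lemma wreg_hasD {m : Ideal A} (rs : List A) : ∀ I : Ideal A, (∀ r ∈ rs, r ∈ m) → WReg I rs →
    HasD m rs.length I := by
  induction rs with
  | nil => intro I _ _; trivial
  | cons r rs ih =>
    intro I hm h
    exact ⟨r, hm r (by simp), h.1, ih _ (fun s hs => hm s (by simp [hs])) h.2⟩

lemma hasD_dim {m : Ideal A} (hm : m ≠ ⊤) (k : ℕ) : ∀ I : Ideal A, I ≤ m → HasD m k I →
    (k : WithBot ℕ∞) ≤ ringKrullDim (A ⧸ I) := by
  induction k with
  | zero =>
    intro I hI _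
    have : Nontrivial (A ⧸ I) := Ideal.Quotient.nontrivial_iff.2 fun h => hm (top_le_iff.1 (h ▸ hI))
    simpa using ringKrullDim_nonneg_of_nontrivial
  | succ k ih =>
    rintro I hI ⟨r, hr, hreg, h⟩
    have h1 := ih _ (sup_le hI ((Ideal.span_singleton_le_iff_mem _).2 hr)) h
    have h2 : Ideal.Quotient.mk I r ∈ nonZeroDivisors (A ⧸ I) := by
      rw [mem_nonZeroDivisors_iff_right]
      intro x hx
      obtain ⟨g, rfl⟩ := Ideal.Quotient.mk_surjective x
      rw [← map_mul, Ideal.Quotient.eq_zero_iff_mem, mul_comm] at hx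
      exact Ideal.Quotient.eq_zero_iff_mem.2 (hreg g hx)
    have h3 := ringKrullDim_quotient_succ_le_of_nonZeroDivisor h2
    have e := DoubleQuot.quotQuotEquivQuotSup I (Ideal.span {r})
    rw [Ideal.map_span, Set.image_singleton] at e
    rw [ringKrullDim_eq_of_ringEquiv e] at h3
    refine le_trans ?_ h3
    push_cast
    gcongr

/-- `m` contains no socle modulo `I`. -/
def NoSoc (m I : Ideal A) : Prop := ∀ g, (∀ r ∈ m, r * g ∈ I) → g ∈ I

lemma RegMod.noSoc {m I : Ideal A} {r : A} (hr : r ∈ m) (h : RegMod I r) : NoSoc m I :=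
  fun g hg => h g (hg r hr)

lemma mem_sup_span {I : Ideal A} {r g : A} : g ∈ I ⊔ Ideal.span {r} ↔ ∃ b, g - r * b ∈ I := by
  rw [Submodule.mem_sup]
  constructor
  · rintro ⟨y, hy, z, hz, rfl⟩
    obtain ⟨b, rfl⟩ := Ideal.mem_span_singleton'.1 hz
    exact ⟨b, by simpa [mul_comm] using hy⟩
  · rintro ⟨b, hb⟩
    exact ⟨_, hb, r * b, Ideal.mul_mem_right _ _ (Ideal.mem_span_singleton_self r), by ring⟩

lemma noSoc_exchange {m I : Ideal A} {r s : A} (hrm : r ∈ m) (hr : RegMod I r) (hs : RegMod I s)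
    (h : NoSoc m (I ⊔ Ideal.span {r})) : NoSoc m (I ⊔ Ideal.span {s}) := by
  intro g hg
  obtain ⟨g', hg'⟩ := mem_sup_span.1 (hg r hrm)
  have h1 : g' ∈ I ⊔ Ideal.span {r} := by
    apply h
    intro a ha
    obtain ⟨b, hb⟩ := mem_sup_span.1 (hg a ha)
    refine mem_sup_span.2 ⟨b, hs _ ?_⟩
    have : s * (a * g' - r * b) = r * (a * g - s * b) - a * (r * g - s * g') := by ring
    rw [this]
    exact I.sub_mem (I.mul_mem_left _ hb) (I.mul_mem_left _ hg')
  obtain ⟨g'', hg''⟩ := mem_sup_span.1 h1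
  refine mem_sup_span.2 ⟨g'', hr _ ?_⟩
  have : r * (g - s * g'') = (r * g - s * g') + s * (g' - r * g'') := by ring
  rw [this]
  exact I.add_mem hg' (I.mul_mem_left _ hg'')

lemma regMod_swap {I : Ideal A} {r t : A} (hr : RegMod I r)
    (ht' : RegMod (I ⊔ Ideal.span {r}) t) : RegMod (I ⊔ Ideal.span {t}) r := by
  intro g hg
  obtain ⟨g', hg'⟩ := mem_sup_span.1 hg
  obtain ⟨g'', hg''⟩ := mem_sup_span.1 (ht' g' (mem_sup_span.2 ⟨g, by
    have : t * g' - r * g = -(r * g - t * g') := by ring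
    rw [this]; exact I.neg_mem hg'⟩))
  refine mem_sup_span.2 ⟨g'', hr _ ?_⟩
  have : r * (g - t * g'') = (r * g - t * g') + t * (g' - r * g'') := by ring
  rw [this]
  exact I.add_mem hg' (I.mul_mem_left _ hg'')

lemma avoid [IsNoetherianRing A] {m : Ideal A} (φ : A →+* A)
    (hφ : ∀ p : Ideal A, p.IsPrime → (∀ s ∈ m, φ s ∈ p) → m ≤ p) (L : Finset (Ideal A))
    (hL : ∀ I ∈ L, NoSoc m I) : ∃ s ∈ m, ∀ I ∈ L, RegMod I (φ s) := by
  classical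
  have hfin : (⋃ I ∈ L, associatedPrimes A (A ⧸ I)).Finite :=
    L.finite_toSet.biUnion fun I _ => associatedPrimes.finite A (A ⧸ I)
  by_contra! hcon
  have hsub : (m : Set A) ⊆ ⋃ p ∈ (hfin.toFinset : Set (Ideal A)), ((p.comap φ : Ideal A) : Set A) := by
    intro s hs
    obtain ⟨I, hI, hn⟩ := hcon s hs
    rw [← regMod_iff] at hn
    have : φ s ∈ ({r | IsSMulRegular (A ⧸ I) r}ᶜ : Set A) := hn
    rw [← biUnion_associatedPrimes_eq_compl_regular] at this
    simp only [Set.mem_iUnion] at this ⊢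
    obtain ⟨p, hp, hsp⟩ := this
    exact ⟨p, by simpa using ⟨I, hI, hp⟩, hsp⟩
  have hprime : ∀ p ∈ hfin.toFinset, p.IsPrime := by
    intro p hp
    simp only [Set.Finite.mem_toFinset, Set.mem_iUnion] at hp
    obtain ⟨I, _, hp⟩ := hp
    exact IsAssociatedPrime.isPrime hp
  rw [Ideal.subset_union_prime ⊤ ⊤ (fun p hp _ _ => by
    have := hprime p hp
    exact Ideal.comap_isPrime φ p)] at hsub
  obtain ⟨p, hp, hmp⟩ := hsub
  have hmp' := hφ p (hprime p hp) hmp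
  simp only [Set.Finite.mem_toFinset, Set.mem_iUnion] at hp
  obtain ⟨I, hI, hp⟩ := hp
  obtain ⟨hpp, x, hx⟩ := isAssociatedPrime_iff.1 (AssociatedPrimes.mem_iff.1 hp)
  obtain ⟨g, rfl⟩ := Ideal.Quotient.mk_surjective x
  have key : ∀ r, r ∈ p ↔ r * g ∈ I := by
    intro r
    rw [hx, Submodule.mem_colon_singleton, Submodule.mem_bot, ← Ideal.Quotient.mk_eq_mk,
      ← Submodule.Quotient.mk_smul, Submodule.Quotient.mk_eq_zero, smul_eq_mul]
  have hg : g ∈ I := hL I hI g fun r hr => (key r).1 (hmp' hr)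
  exact hpp.ne_top ((Ideal.eq_top_iff_one _).2 ((key 1).2 (by simpa using hg)))

lemma exchange [IsNoetherianRing A] {m : Ideal A} (k : ℕ) : ∀ (I : Ideal A) (s : A), s ∈ m →
    RegMod I s → HasD m (k + 1) I → HasD m k (I ⊔ Ideal.span {s}) := by
  classical
  induction k with
  | zero => intros; trivial
  | succ k ih =>
    rintro I s hs hreg ⟨r, hr, hrr, h⟩
    obtain ⟨r2, hr2, hrr2, h2⟩ := id h
    have n1 : NoSoc m (I ⊔ Ideal.span {r}) := hrr2.noSoc hr2
    have n2 : NoSoc m (I ⊔ Ideal.span {s}) := noSoc_exchange hr hrr hreg n1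
    obtain ⟨t, ht, hT⟩ := avoid (RingHom.id A) (m := m) (fun p _ h => h)
      {I, I ⊔ Ideal.span {r}, I ⊔ Ideal.span {s}} (by
        simp only [Finset.mem_insert, Finset.mem_singleton]
        rintro _ (rfl | rfl | rfl)
        · exact hreg.noSoc hs
        · exact n1
        · exact n2)
    simp only [Finset.mem_insert, Finset.mem_singleton, RingHom.id_apply, forall_eq_or_imp,
      forall_eq] at hT
    obtain ⟨t0, t1, t2⟩ := hT
    have h3 := ih _ t ht t1 h
    have h4 : HasD m (k + 1) (I ⊔ Ideal.span {t}) :=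
      ⟨r, hr, regMod_swap hrr t1, by rwa [sup_right_comm]⟩
    have h5 := ih _ s hs (regMod_swap hreg t2) h4
    exact ⟨t, ht, t2, by rwa [sup_right_comm]⟩

lemma hasD_special [IsNoetherianRing A] {m : Ideal A} (φ : A →+* A) (hm : ∀ s ∈ m, φ s ∈ m)
    (hφ : ∀ p : Ideal A, p.IsPrime → (∀ s ∈ m, φ s ∈ p) → m ≤ p) (k : ℕ) : ∀ I : Ideal A,
    HasD m k I → ∃ ss : List A, ss.length = k ∧ (∀ s ∈ ss, s ∈ m) ∧ WReg I (ss.map φ) := by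
  induction k with
  | zero => intro I _; exact ⟨[], rfl, by simp, trivial⟩
  | succ k ih =>
    intro I h
    obtain ⟨r, hr, hrr, _⟩ := id h
    obtain ⟨s, hs, hreg⟩ := avoid φ hφ {I} (by simpa using hrr.noSoc hr)
    simp only [Finset.mem_singleton, forall_eq] at hreg
    obtain ⟨ss, hl, hss, hw⟩ := ih _ (exchange k I (φ s) (hm s hs) hreg h)
    exact ⟨s :: ss, by simp [hl], by simpa using ⟨hs, hss⟩, hreg, hw⟩

/-- Transfer of weak regularity along a retract, linear over the image of `φ`. -/
lemma wreg_retract {ι : Type*} [Fintype ι] (φ : A →+* A) (ψ θ : ι → A →+ A)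
    (hψ : ∀ i s g, ψ i (φ s * g) = φ s * ψ i g) (hθ : ∀ i s g, θ i (φ s * g) = φ s * θ i g)
    (hid : ∀ g, ∑ i, θ i (ψ i g) = g) (ss : List A) : ∀ I I' : Ideal A,
    (∀ i, ∀ g ∈ I', ψ i g ∈ I) → (∀ i, ∀ g ∈ I, θ i g ∈ I') →
    WReg I (ss.map φ) → WReg I' (ss.map φ) := by
  induction ss with
  | nil => intros; trivial
  | cons s ss ih =>
    rintro I I' h1 h2 ⟨hr, hw⟩
    refine ⟨?_, ih _ _ ?_ ?_ hw⟩
    · intro g hg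
      rw [← hid g]
      refine Ideal.sum_mem _ fun i _ => h2 i _ (hr _ ?_)
      rw [← hψ]
      exact h1 i _ hg
    · intro i g hg
      obtain ⟨b, hb⟩ := mem_sup_span.1 hg
      exact mem_sup_span.2 ⟨ψ i b, by rw [← hψ, ← map_sub]; exact h1 i _ hb⟩
    · intro i g hg
      obtain ⟨b, hb⟩ := mem_sup_span.1 hg
      exact mem_sup_span.2 ⟨θ i b, by rw [← hθ, ← map_sub]; exact h2 i _ hb⟩

end general

section mono
variable {n : ℕ} (K : Type*) [Field K]

/-- The `K`-linear map sending `x^b` to `x^(f b)` if `p b` and to `0` otherwise. -/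
noncomputable def monoMap (p : (Fin n →₀ ℕ) → Prop) (f : (Fin n →₀ ℕ) → (Fin n →₀ ℕ)) :
    MvPolynomial (Fin n) K →ₗ[K] MvPolynomial (Fin n) K :=
  open Classical in
  (basisMonomials (Fin n) K).constr K fun b => if p b then monomial (f b) 1 else 0

open Classical in
lemma monoMap_monomial (p : (Fin n →₀ ℕ) → Prop) (f : (Fin n →₀ ℕ) → (Fin n →₀ ℕ))
    (b : Fin n →₀ ℕ) (c : K) :
    monoMap K p f (monomial b c) = if p b then monomial (f b) c else 0 := by
  have h : (monomial b c : MvPolynomial (Fin n) K) = c • basisMonomials (Fin n) K b := by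
    simp [smul_monomial]
  rw [h, map_smul, monoMap, Module.Basis.constr_basis]
  split_ifs <;> simp [smul_monomial]

lemma monoMap_mul (p : (Fin n →₀ ℕ) → Prop) (f : (Fin n →₀ ℕ) → (Fin n →₀ ℕ)) (q : ℕ)
    (hp : ∀ b c, p (q • c + b) ↔ p b) (hf : ∀ b c, p b → f (q • c + b) = q • c + f b)
    (s g : MvPolynomial (Fin n) K) :
    monoMap K p f (expand q s * g) = expand q s * monoMap K p f g := by
  classical
  induction s using MvPolynomial.induction_on' with
  | add s s' h h' => rw [map_add, add_mul, map_add, h, h', add_mul]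
  | monomial c a =>
    induction g using MvPolynomial.induction_on' with
    | add g g' h h' => rw [mul_add, map_add, h, h', map_add, mul_add]
    | monomial b a' =>
      rw [expand_monomial, monomial_mul, monoMap_monomial, monoMap_monomial]
      by_cases hb : p b
      · rw [if_pos hb, if_pos ((hp b c).2 hb), hf b c hb, monomial_mul]
      · rw [if_neg hb, if_neg (fun h => hb ((hp b c).1 h)), mul_zero]

lemma monoMap_mem (p : (Fin n →₀ ℕ) → Prop) (f : (Fin n →₀ ℕ) → (Fin n →₀ ℕ))
    {C C' : (Fin n →₀ ℕ) → Prop} (h : ∀ b, p b → C b → C' (f b))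
    {I I' : Ideal (MvPolynomial (Fin n) K)} (hI : ∀ g ∈ I, ∀ b ∈ g.support, C b)
    (hI' : ∀ b c, C' b → monomial b c ∈ I') (g : MvPolynomial (Fin n) K) (hg : g ∈ I) :
    monoMap K p f g ∈ I' := by
  classical
  rw [g.as_sum, map_sum]
  refine Ideal.sum_mem _ fun b hb => ?_
  rw [monoMap_monomial]
  split_ifs with hp
  · exact hI' _ _ (h b hp (hI g hg b hb))
  · exact I'.zero_mem

variable (G : SimpleGraph (Fin n)) [DecidableRel G.Adj]

/-- Exponents of monomials in the `t`-th symbolic power of the cover ideal. -/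
def CovExp (t : ℕ) (b : Fin n →₀ ℕ) : Prop := ∀ u v, G.Adj u v → t ≤ b u + b v

lemma mem_coverIdeal (g : MvPolynomial (Fin n) K) :
    g ∈ graphCoverIdeal K G ↔ ∀ b ∈ g.support, CovExp G 1 b := by
  have h : ∀ e : Sym2 (Fin n), {p : MvPolynomial (Fin n) K | ∃ i ∈ e, p = X i} =
      X '' {i | i ∈ e} := by
    intro e; ext p; simp [eq_comm]
  simp only [graphCoverIdeal, Ideal.mem_iInf, h, mem_ideal_span_X_image]
  constructor
  · intro H b hb u v huv
    obtain ⟨i, hi, hbi⟩ := H s(u, v) (by simpa using huv) b hb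
    simp only [Set.mem_setOf_eq, Sym2.mem_iff] at hi
    rcases hi with rfl | rfl <;> omega
  · intro H e he b hb
    induction e with
    | h u v =>
      have := H b hb u v (by simpa using he)
      by_cases hu : b u = 0
      · exact ⟨v, by simp, by omega⟩
      · exact ⟨u, by simp, hu⟩

lemma coverExp_of_mem_pow (t : ℕ) : ∀ g ∈ graphCoverIdeal K G ^ t, ∀ b ∈ g.support,
    CovExp G t b := by
  classical
  induction t with
  | zero => intro g _ b _ u v _; omega
  | succ t ih =>
    intro g hg
    rw [pow_succ] at hg
    refine Submodule.mul_induction_on hg ?_ ?_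
    · intro x hx y hy b hb u v huv
      obtain ⟨b1, h1, b2, h2, rfl⟩ := Finset.mem_add.1 (support_mul x y hb)
      have := ih x hx b1 h1 u v huv
      have := (mem_coverIdeal K G y).1 hy b2 h2 u v huv
      simp only [Finsupp.add_apply]; omega
    · intro x y hx hy b hb
      rcases Finset.mem_union.1 (support_add hb) with h | h
      · exact hx b h
      · exact hy b h

lemma monomial_mem_pow_s14 (f : Fin n → Bool) (hf : ∀ {u v : Fin n}, G.Adj u v → f u ≠ f v)
    (t : ℕ) : ∀ (b : Fin n →₀ ℕ) (c : K), CovExp G t b →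
    monomial b c ∈ graphCoverIdeal K G ^ t := by
  classical
  induction t with
  | zero => intros; simp
  | succ t ih =>
    intro b c hb
    -- peel off the cover: `u` on the `true` side with `b u ≥ 1`, `v` on the other with `b v ≥ t+1`
    let d : Fin n →₀ ℕ := Finsupp.equivFunOnFinite.symm fun i =>
      if (f i = true ∧ 1 ≤ b i) ∨ (f i = false ∧ t + 1 ≤ b i) then 1 else 0
    have hd : ∀ i, d i = if (f i = true ∧ 1 ≤ b i) ∨ (f i = false ∧ t + 1 ≤ b i) then 1 else 0 :=
      fun i => rfl
    have hdb : d ≤ b := by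
      intro i; rw [hd]; split_ifs <;> omega
    have h1 : monomial d (1 : K) ∈ graphCoverIdeal K G := by
      rw [mem_coverIdeal]
      intro b' hb' u v huv
      have : b' = d := by
        have := support_monomial_subset hb'
        simpa using this
      subst this
      have := hf huv
      have := hb u v huv
      rw [hd, hd]
      cases hu : f u <;> cases hv : f v <;> simp_all <;> split_ifs <;> omega
    have h2 : monomial (b - d) c ∈ graphCoverIdeal K G ^ t := by
      apply ih
      intro u v huv
      have := hf huv
      have := hb u v huv
      simp only [Finsupp.tsub_apply, hd]
      cases hu : f u <;> cases hv : f v <;> simp_all <;> split_ifs <;> omega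
    have h3 : monomial b c = monomial (b - d) c * monomial d (1 : K) := by
      rw [monomial_mul, tsub_add_cancel_of_le hdb, mul_one]
    rw [h3, pow_succ]
    exact Ideal.mul_mem_mul h2 h1

end mono

section transfer
variable {n : ℕ} (K : Type*) [Field K]

/-- The shift vector attached to a residue vector. -/
noncomputable def shiftVec (f : Fin n → Bool) (t : ℕ) (ρ : Fin n → Fin (t + 2)) : Fin n →₀ ℕ :=
  Finsupp.equivFunOnFinite.symm fun i => if f i = true ∧ (ρ i : ℕ) ≠ t + 1 then 1 else 0

lemma shiftVec_apply (f : Fin n → Bool) (t : ℕ) (ρ : Fin n → Fin (t + 2)) (i : Fin n) :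
    shiftVec f t ρ i = if f i = true ∧ (ρ i : ℕ) ≠ t + 1 then 1 else 0 := rfl

lemma wreg_transfer (G : SimpleGraph (Fin n)) [DecidableRel G.Adj] (f : Fin n → Bool)
    (hf : ∀ {u v : Fin n}, G.Adj u v → f u ≠ f v) (t : ℕ)
    (ss : List (MvPolynomial (Fin n) K))
    (h : WReg (graphCoverIdeal K G ^ (t + 1))
      (ss.map (expand (t + 2) : MvPolynomial (Fin n) K →ₐ[K] _).toRingHom)) :
    WReg (graphCoverIdeal K G ^ t)
      (ss.map (expand (t + 2) : MvPolynomial (Fin n) K →ₐ[K] _).toRingHom) := by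
  classical
  let pψ : (Fin n → Fin (t + 2)) → (Fin n →₀ ℕ) → Prop := fun ρ b => ∀ i, b i % (t + 2) = ρ i
  let pθ : (Fin n → Fin (t + 2)) → (Fin n →₀ ℕ) → Prop := fun ρ b =>
    ∀ i, b i % (t + 2) = ρ i + shiftVec f t ρ i
  let ψ := fun ρ => (monoMap K (pψ ρ) (fun b => b + shiftVec f t ρ)).toAddMonoidHom
  let θ := fun ρ => (monoMap K (pθ ρ) (fun b => b - shiftVec f t ρ)).toAddMonoidHom
  refine wreg_retract _ ψ θ ?_ ?_ ?_ ss _ _ ?_ ?_ h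
  · intro ρ s g
    refine monoMap_mul K _ _ _ ?_ ?_ s g
    · intro b c; simp [pψ, Nat.mul_add_mod]
    · intro b c _; exact add_assoc _ _ _
  · intro ρ s g
    refine monoMap_mul K _ _ _ ?_ ?_ s g
    · intro b c; simp [pθ, Nat.mul_add_mod]
    · intro b c hb
      refine add_tsub_assoc_of_le (fun i => ?_) _
      have h1 := hb i
      have h2 := Nat.mod_le (b i) (t + 2)
      omega
  · intro g
    induction g using MvPolynomial.induction_on' with
    | add g g' h h' => simp only [map_add, Finset.sum_add_distrib, h, h']
    | monomial b c =>
      rw [Finset.sum_eq_single (fun i => ⟨b i % (t + 2), Nat.mod_lt _ (by omega)⟩)]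
      · change monoMap K _ _ (monoMap K _ _ _) = _
        rw [monoMap_monomial, if_pos (fun i => rfl), monoMap_monomial, if_pos, add_tsub_cancel_right]
        intro i
        have hlt := Nat.mod_lt (b i) (show t + 2 > 0 by omega)
        rw [Finsupp.add_apply, shiftVec_apply]
        split_ifs with hc
        · simp only at hc
          rw [Nat.add_mod, Nat.mod_eq_of_lt (a := 1) (by omega), Nat.mod_eq_of_lt (by omega)]
        · simp
      · intro ρ _ hρ
        change monoMap K _ _ (monoMap K _ _ _) = _
        rw [monoMap_monomial, if_neg, map_zero]
        intro hb
        apply hρ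
        funext i
        exact Fin.ext (hb i).symm
      · simp
  · intro ρ
    refine monoMap_mem K _ _ (C := CovExp G t) (C' := CovExp G (t + 1)) ?_
      (coverExp_of_mem_pow K G t) (monomial_mem_pow_s14 K G f hf (t + 1))
    intro b hb hC u v huv
    have h1 := hf huv
    have h2 := hC u v huv
    have h3 := hb u
    have h4 := hb v
    have h5 := Nat.mod_le (b u) (t + 2)
    have h6 := Nat.mod_le (b v) (t + 2)
    simp only [Finsupp.add_apply, shiftVec_apply]
    cases hu : f u <;> cases hv : f v <;> simp_all <;> split_ifs <;> omega
  · intro ρ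
    refine monoMap_mem K _ _ (C := CovExp G (t + 1)) (C' := CovExp G t) ?_
      (coverExp_of_mem_pow K G (t + 1)) (monomial_mem_pow_s14 K G f hf t)
    intro b hb hC u v huv
    have h1 := hf huv
    have h2 := hC u v huv
    simp only [Finsupp.tsub_apply, shiftVec_apply]
    cases hu : f u <;> cases hv : f v <;> simp_all <;> split_ifs <;> omega

end transfer

/-- For a bipartite graph `G`, the depth function `t ↦ depth R/J(G)^t` is non-increasing. -/
theorem depth_graphCoverIdeal_pow_antitone {n : ℕ} (K : Type*) [Field K]
    (G : SimpleGraph (Fin n)) [DecidableRel G.Adj]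
    (hbip : ∃ f : Fin n → Bool, ∀ {u v : Fin n}, G.Adj u v → f u ≠ f v) :
    ∀ t : ℕ, 1 ≤ t →
      quotDepth K ((graphCoverIdeal K G) ^ (t + 1)) ≤ quotDepth K ((graphCoverIdeal K G) ^ t) := by
  obtain ⟨f, hf⟩ := hbip
  intro t ht
  classical
  set m : Ideal (MvPolynomial (Fin n) K) :=
    Ideal.span (Set.range (X : Fin n → MvPolynomial (Fin n) K)) with hm
  have hmem : ∀ g : MvPolynomial (Fin n) K, g ∈ m ↔ ∀ b ∈ g.support, ∃ i, b i ≠ 0 := by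
    intro g
    rw [hm, ← Set.image_univ, mem_ideal_span_X_image]
    simp
  have hmtop : m ≠ ⊤ := by
    intro h
    have h1 := (hmem 1).1 (h ▸ Submodule.mem_top) 0 (by simp)
    simp at h1
  -- proper powers lie in `m`
  have hJ : ∀ s, graphCoverIdeal K G ^ s ≠ ⊤ → graphCoverIdeal K G ^ s ≤ m := by
    intro s hs g hg
    rw [hmem]
    intro b hb
    by_contra! h0
    have hb0 : b = 0 := Finsupp.ext h0
    subst hb0
    apply hs
    rw [Ideal.eq_top_iff_one]
    exact monomial_mem_pow_s14 K G f hf s 0 1 (coverExp_of_mem_pow K G s g hg 0 hb)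
  by_cases htop : graphCoverIdeal K G ^ (t + 1) = ⊤
  · have : {k : ℕ | ∃ rs : List (MvPolynomial (Fin n) K), rs.length = k ∧
        (∀ r ∈ rs, r ∈ m) ∧ RingTheory.Sequence.IsRegular
          (MvPolynomial (Fin n) K ⧸ graphCoverIdeal K G ^ (t + 1)) rs} = ∅ := by
      rw [Set.eq_empty_iff_forall_notMem]
      rintro k ⟨rs, _, _, hr⟩
      have := hr.nontrivial
      exact Ideal.Quotient.nontrivial_iff.1 this htop
    unfold quotDepth
    rw [← hm, this]
    simp
  have htop' : graphCoverIdeal K G ^ t ≠ ⊤ := by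
    intro h
    apply htop
    rw [Ideal.pow_eq_top_iff] at h ⊢
    left
    rcases h with h | h
    · exact h
    · omega
  have hsup : ∀ (I : Ideal (MvPolynomial (Fin n) K)) (rs : List (MvPolynomial (Fin n) K)),
      I ≤ m → (∀ r ∈ rs, r ∈ m) → (RingTheory.Sequence.IsRegular (MvPolynomial (Fin n) K ⧸ I) rs ↔
        WReg I rs) := by
    intro I rs hI hrs
    rw [RingTheory.Sequence.isRegular_iff, wreg_iff]
    refine and_iff_left ?_
    intro h
    have h1 : Ideal.ofList rs ≤ m := Ideal.span_le.2 hrs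
    have h2 : (Ideal.Quotient.mk I 1) ∈ (m • ⊤ : Submodule _ (MvPolynomial (Fin n) K ⧸ I)) :=
      Submodule.smul_mono_left h1 (h ▸ Submodule.mem_top)
    have h3 : (m • ⊤ : Submodule _ (MvPolynomial (Fin n) K ⧸ I)) = Submodule.map I.mkQ m := by
      rw [← Submodule.range_mkQ I, LinearMap.range_eq_map, ← Submodule.map_smul'']
      simp
    rw [h3] at h2
    obtain ⟨g, hg, hg1⟩ := h2
    have h4 : g - 1 ∈ I := Ideal.Quotient.eq.1 hg1
    apply hmtop
    rw [Ideal.eq_top_iff_one]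
    have : (1 : MvPolynomial (Fin n) K) = g - (g - 1) := by ring
    rw [this]
    exact m.sub_mem hg (hI h4)
  have hφm : ∀ s ∈ m, (expand (t + 2) : MvPolynomial (Fin n) K →ₐ[K] _).toRingHom s ∈ m := by
    intro s hs
    change s ∈ m.comap _
    revert s
    change m ≤ _
    rw [hm, Ideal.span_le]
    rintro _ ⟨i, rfl⟩
    change expand (t + 2) (X i) ∈ m
    rw [expand_X]
    have hX : (X i : MvPolynomial (Fin n) K) ∈ m := Ideal.subset_span ⟨i, rfl⟩
    exact Ideal.pow_mem_of_mem _ hX _ (by omega)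
  have hφp : ∀ p : Ideal (MvPolynomial (Fin n) K), p.IsPrime →
      (∀ s ∈ m, (expand (t + 2) : MvPolynomial (Fin n) K →ₐ[K] _).toRingHom s ∈ p) → m ≤ p := by
    intro p hp h
    rw [hm, Ideal.span_le]
    rintro _ ⟨i, rfl⟩
    have hX : (X i : MvPolynomial (Fin n) K) ∈ m := Ideal.subset_span ⟨i, rfl⟩
    have h1 : expand (t + 2) (X i) ∈ p := h (X i) hX
    rw [expand_X] at h1
    exact hp.mem_of_pow_mem _ h1
  unfold quotDepth
  refine csSup_le' ?_
  rintro k ⟨rs, rfl, hrs, hreg⟩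
  refine le_csSup ?_ ?_
  · refine ⟨n, ?_⟩
    rintro k ⟨rs, rfl, hrs, hreg⟩
    have h1 := hasD_dim hmtop _ _ (hJ t htop') (wreg_hasD rs _ hrs ((hsup _ _ (hJ t htop') hrs).1 hreg))
    have h2 := h1.trans (ringKrullDim_quotient_le _)
    rw [MvPolynomial.ringKrullDim_of_isNoetherianRing] at h2
    simpa [ringKrullDim_eq_zero_of_field] using h2
  · obtain ⟨ss, hl, hss, hw⟩ := hasD_special _ hφm hφp _ _
      (wreg_hasD rs _ hrs ((hsup _ _ (hJ _ htop) hrs).1 hreg))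
    have hmm : ∀ r ∈ ss.map (expand (t + 2) : MvPolynomial (Fin n) K →ₐ[K] _).toRingHom, r ∈ m := by
      intro r hr
      obtain ⟨s, hs, rfl⟩ := List.mem_map.1 hr
      exact hφm s (hss s hs)
    exact ⟨_, by rw [List.length_map, hl], hmm, (hsup _ _ (hJ t htop') hmm).2
      (wreg_transfer K G f hf t ss hw)⟩
end
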